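/- arXiv:0906.1559 — 2 statements merged into one kernel-verified Lean document; each statement's English description precedes it below -/
import Mathlib

section
/- The generating function for ℓ-partitions by largest part is B_ℓ(x) = (1 - x^{ℓ-1}) / ((1-x)^{ℓ-1} (1 - x^{ℓ-1} - x^ℓ)) as a formal power series identity, where the coefficient of x^k in B_ℓ(x) is the number of ℓ-partitions with largest part k. -/
/-- The hook length of the box `(a, b)` (0-indexed row `a`, column `b`)
of the Young diagram `μ`: the number of boxes to the right in its row,
plus the number of boxes below in its column, plus one. -/
def hookLen (μ : YoungDiagram) (a b : ℕ) : ℕ :=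
  μ.rowLen a + μ.colLen b - a - b - 1

/-- A partition (Young diagram) is an `ℓ`-core when no box has hook length
divisible by `ℓ`. -/
def IsCore (ℓ : ℕ) (μ : YoungDiagram) : Prop :=
  ∀ a b : ℕ, (a, b) ∈ μ → ¬ ℓ ∣ hookLen μ a b

/-- Two cells are adjacent if they share an edge. -/
def AdjCell (p q : ℕ × ℕ) : Prop :=
  (p.1 = q.1 ∧ (p.2 = q.2 + 1 ∨ q.2 = p.2 + 1)) ∨
  (p.2 = q.2 ∧ (p.1 = q.1 + 1 ∨ q.1 = p.1 + 1))

/-- A finite set of cells is connected if any two of its cells are joined by a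
path of edge-adjacent cells inside the set. -/
def ConnectedCells (s : Finset (ℕ × ℕ)) : Prop :=
  ∀ p ∈ s, ∀ q ∈ s,
    Relation.ReflTransGen (fun x y => x ∈ s ∧ y ∈ s ∧ AdjCell x y) p q

/-- A set of cells contains no 2×2 square. -/
def No2x2 (s : Finset (ℕ × ℕ)) : Prop :=
  ¬ ∃ a b : ℕ, (a, b) ∈ s ∧ (a + 1, b) ∈ s ∧ (a, b + 1) ∈ s ∧ (a + 1, b + 1) ∈ s

/-- `s` is a removable `ℓ`-rim hook of the Young diagram `lam`: a connected set of
`ℓ` cells of `lam`, containing no 2×2 square, whose removal from `lam` leaves the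
Young diagram of a partition. -/
def IsRemovableRimHook (ℓ : ℕ) (lam : YoungDiagram) (s : Finset (ℕ × ℕ)) : Prop :=
  ∃ μ : YoungDiagram, μ.cells ⊆ lam.cells ∧ s = lam.cells \ μ.cells ∧
    s.card = ℓ ∧ ConnectedCells s ∧ No2x2 s

/-- A set of cells all lying in a single row. -/
def HorizontalCells (s : Finset (ℕ × ℕ)) : Prop := ∀ p ∈ s, ∀ q ∈ s, p.1 = q.1

/-- A set of cells all lying in a single column. -/
def VerticalCells (s : Finset (ℕ × ℕ)) : Prop := ∀ p ∈ s, ∀ q ∈ s, p.2 = q.2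

/-- Carter's condition (⋆): for all pairs of boxes in the same column of `lam`,
`ℓ` divides one hook length iff it divides the other. -/
def StarCond (ℓ : ℕ) (lam : YoungDiagram) : Prop :=
  ∀ a b c : ℕ, (a, c) ∈ lam → (b, c) ∈ lam →
    (ℓ ∣ hookLen lam a c ↔ ℓ ∣ hookLen lam b c)

/-- `b` is obtained from `a` by removing a horizontal `ℓ`-rim hook;
equivalently `a` is obtained from `b` by adding a horizontal `ℓ`-rim hook. -/
def RemoveHorizHook (ℓ : ℕ) (a b : YoungDiagram) : Prop :=
  ∃ s, IsRemovableRimHook ℓ a s ∧ HorizontalCells s ∧ b.cells = a.cells \ s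

/-- A partition is `ℓ`-regular if it has no `ℓ` equal nonzero parts. -/
def Regular (ℓ : ℕ) (lam : YoungDiagram) : Prop :=
  ∀ i : ℕ, lam.rowLen i = lam.rowLen (i + ℓ - 1) → lam.rowLen i = 0

/-- An `ℓ`-partition: an `ℓ`-regular partition each of whose removable `ℓ`-rim hooks
is horizontal, and such that this remains true after removing any sequence of
horizontal `ℓ`-rim hooks. -/
def IsEllPartition (ℓ : ℕ) (lam : YoungDiagram) : Prop :=
  Regular ℓ lam ∧
  ∀ μ : YoungDiagram, Relation.ReflTransGen (RemoveHorizHook ℓ) lam μ →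
    ∀ s, IsRemovableRimHook ℓ μ s → HorizontalCells s

namespace YoungDiagram

theorem rowLen_injective : Function.Injective rowLen := by
  intro lam mu h
  ext ⟨a, b⟩
  rw [mem_cells, mem_cells, mem_iff_lt_rowLen, mem_iff_lt_rowLen, h]

/-- The Young diagram with a prescribed antitone, eventually zero sequence of row lengths. -/
theorem exists_rowLen_eq {f : ℕ → ℕ} (hf : Antitone f) {N : ℕ} (hN : f N = 0) :
    ∃ mu : YoungDiagram, ∀ i, mu.rowLen i = f i := by
  have hmem : ∀ c : ℕ × ℕ,
      c ∈ (Finset.range N ×ˢ Finset.range (f 0)).filter (fun c => c.2 < f c.1) ↔ c.2 < f c.1 := by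
    rintro ⟨a, b⟩
    simp only [Finset.mem_filter, Finset.mem_product, Finset.mem_range, and_iff_right_iff_imp]
    intro h
    refine ⟨?_, h.trans_le (hf (Nat.zero_le a))⟩
    by_contra! hNa
    have := hf hNa
    omega
  let mu : YoungDiagram :=
    { cells := (Finset.range N ×ˢ Finset.range (f 0)).filter (fun c => c.2 < f c.1)
      isLowerSet := by
        rintro ⟨a, b⟩ ⟨c, d⟩ ⟨h1, h2⟩ h
        rw [Finset.mem_coe, hmem] at h ⊢
        exact lt_of_le_of_lt h2 (lt_of_lt_of_le h (hf h1)) }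
  refine ⟨mu, fun i => ?_⟩
  have key : ∀ j, j < mu.rowLen i ↔ j < f i := fun j => by
    rw [← mem_iff_lt_rowLen, ← mem_cells]
    exact hmem (i, j)
  exact le_antisymm (not_lt.1 fun h => lt_irrefl _ ((key _).1 h))
    (not_lt.1 fun h => lt_irrefl _ ((key _).2 h))

theorem exists_rowLen_eq_zero (lam : YoungDiagram) : ∃ N, lam.rowLen N = 0 := by
  refine ⟨lam.colLen 0, ?_⟩
  by_contra h
  have := mem_iff_lt_colLen.1 (mem_iff_lt_rowLen.2 (Nat.pos_of_ne_zero h))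
  omega

/-- The `i`-th bead of the Maya diagram of `lam`. -/
def bead (lam : YoungDiagram) (i : ℕ) : ℤ := lam.rowLen i - i - 1

/-- The Maya diagram of `lam`. -/
def beads (lam : YoungDiagram) : Set ℤ := Set.range lam.bead

theorem bead_strictAnti (lam : YoungDiagram) : StrictAnti lam.bead := by
  intro i j h
  have := lam.rowLen_anti i j h.le
  unfold bead
  omega

theorem bead_mem (lam : YoungDiagram) (i : ℕ) : lam.bead i ∈ lam.beads := ⟨i, rfl⟩

theorem notMem_beads_of_between {lam : YoungDiagram} {i : ℕ} {z : ℤ} (h1 : z < lam.bead i)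
    (h2 : lam.bead (i + 1) < z) : z ∉ lam.beads := by
  rintro ⟨r, rfl⟩
  rw [lam.bead_strictAnti.lt_iff_gt] at h1 h2
  omega

theorem le_bead_zero {lam : YoungDiagram} {z : ℤ} (h : z ∈ lam.beads) : z ≤ lam.bead 0 := by
  obtain ⟨r, rfl⟩ := h
  exact lam.bead_strictAnti.antitone (Nat.zero_le r)

theorem beads_injective : Function.Injective beads := by
  intro lam mu h
  have h1 : StrictMono fun i => -lam.bead i := fun i j hij => neg_lt_neg (lam.bead_strictAnti hij)
  have h2 : StrictMono fun i => -mu.bead i := fun i j hij => neg_lt_neg (mu.bead_strictAnti hij)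
  have h3 : (fun i => -lam.bead i) = fun i => -mu.bead i := by
    rw [← h1.range_inj h2]
    ext z
    have := Set.ext_iff.1 h (-z)
    simpa [beads, neg_eq_iff_eq_neg] using this
  refine rowLen_injective (funext fun i => ?_)
  have := congrFun h3 i
  simp only [bead] at this
  omega

/-- Below any level lying under the top bead, there is a last bead above that level. -/
theorem exists_last_bead_gt (lam : YoungDiagram) {i : ℕ} {z : ℤ} (h : z < lam.bead i) :
    ∃ j, i ≤ j ∧ z < lam.bead j ∧ lam.bead (j + 1) ≤ z := by
  have hex : ∃ j, lam.bead j ≤ z := by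
    obtain ⟨N, hN⟩ := lam.exists_rowLen_eq_zero
    refine ⟨N + z.natAbs, ?_⟩
    have := lam.rowLen_anti N (N + z.natAbs) (by omega)
    unfold bead
    omega
  classical
  have hspec := Nat.find_spec hex
  have hmin := fun {m} => Nat.find_min hex (m := m)
  have hi : i < Nat.find hex := by
    by_contra! hc
    have := lam.bead_strictAnti.antitone hc
    omega
  refine ⟨Nat.find hex - 1, by omega, ?_, ?_⟩
  · exact not_le.1 (hmin (m := Nat.find hex - 1) (by omega))
  · rwa [Nat.sub_add_cancel (by omega)]

/-- `mu` arises from `lam` by removing a rim hook with `ℓ` boxes that occupies the rows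
from `i` to `j`. -/
structure IsRimStrip (ℓ : ℕ) (lam mu : YoungDiagram) (i j : ℕ) : Prop where
  le : i ≤ j
  outside : ∀ r, r < i ∨ j < r → mu.rowLen r = lam.rowLen r
  inside : ∀ r, i ≤ r → r < j → mu.rowLen r + 1 = lam.rowLen (r + 1)
  last_lt : mu.rowLen j < lam.rowLen j
  size : mu.rowLen j + ℓ + i = lam.rowLen i + j

theorem mem_sdiff_cells {lam mu : YoungDiagram} {a b : ℕ} :
    (a, b) ∈ lam.cells \ mu.cells ↔ mu.rowLen a ≤ b ∧ b < lam.rowLen a := by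
  rw [Finset.mem_sdiff, mem_cells, mem_cells, mem_iff_lt_rowLen, mem_iff_lt_rowLen]
  omega

theorem card_sdiff_of_rows {lam mu : YoungDiagram} {i j : ℕ} (hij : i ≤ j)
    (houtside : ∀ r, r < i ∨ j < r → mu.rowLen r = lam.rowLen r)
    (hinside : ∀ r, i ≤ r → r < j → mu.rowLen r + 1 = lam.rowLen (r + 1))
    (hlast : mu.rowLen j < lam.rowLen j) :
    (lam.cells \ mu.cells).card + mu.rowLen j + i = lam.rowLen i + j := by
  have hmaps : Set.MapsTo Prod.fst (↑(lam.cells \ mu.cells) : Set (ℕ × ℕ))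
      (↑(Finset.Ico i (j + 1)) : Set ℕ) := by
    rintro ⟨a, b⟩ h
    rw [Finset.mem_coe, mem_sdiff_cells] at h
    rw [Finset.mem_coe, Finset.mem_Ico]
    have := houtside a
    omega
  have hfiber : ∀ r, ((lam.cells \ mu.cells).filter fun c => c.1 = r).card =
      lam.rowLen r - mu.rowLen r := by
    intro r
    rw [← Nat.card_Ico, ← (Finset.Ico _ _).card_map ⟨Prod.mk r, Prod.mk_right_injective r⟩]
    congr 1
    ext ⟨a, b⟩
    simp only [Finset.mem_filter, mem_sdiff_cells, Finset.mem_map, Finset.mem_Ico,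
      Function.Embedding.coeFn_mk, Prod.mk.injEq]
    constructor
    · rintro ⟨h, rfl⟩
      exact ⟨b, h, rfl, rfl⟩
    · rintro ⟨_, h, rfl, rfl⟩
      exact ⟨h, rfl⟩
  have hsum : ∀ m, i ≤ m → m ≤ j →
      (∑ r ∈ Finset.Ico i m, (lam.rowLen r - mu.rowLen r)) + lam.rowLen m + i
        = lam.rowLen i + m := by
    intro m him
    induction m, him using Nat.le_induction with
    | base => simp
    | succ m him ih =>
      intro hm
      have h1 := ih (by omega)
      have h2 := hinside m him (by omega)
      have h3 := lam.rowLen_anti m (m + 1) (by omega)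
      rw [Finset.sum_Ico_succ_top him]
      omega
  have h1 := hsum j hij le_rfl
  rw [Finset.card_eq_sum_card_fiberwise hmaps, Finset.sum_congr rfl fun r _ => hfiber r,
    Finset.sum_Ico_succ_top hij]
  omega

namespace IsRimStrip

variable {ℓ : ℕ} {lam mu : YoungDiagram} {i j : ℕ}

theorem rowLen_le (h : IsRimStrip ℓ lam mu i j) (r : ℕ) : mu.rowLen r ≤ lam.rowLen r := by
  have h1 := h.outside r
  have h2 := h.inside r
  have h3 := lam.rowLen_anti r (r + 1) (by omega)
  rcases lt_trichotomy r j with hr | rfl | hr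
  · by_cases hi : r < i <;> omega
  · exact h.last_lt.le
  · omega

theorem cells_subset (h : IsRimStrip ℓ lam mu i j) : mu.cells ⊆ lam.cells := by
  rintro ⟨a, b⟩ hab
  rw [mem_cells, mem_iff_lt_rowLen] at hab ⊢
  exact hab.trans_le (h.rowLen_le a)

theorem row_mem (h : IsRimStrip ℓ lam mu i j) {a b : ℕ} (hab : (a, b) ∈ lam.cells \ mu.cells) :
    i ≤ a ∧ a ≤ j := by
  rw [mem_sdiff_cells] at hab
  have := h.outside a
  omega

theorem rowLen_lt (h : IsRimStrip ℓ lam mu i j) {r : ℕ} (hi : i ≤ r) (hj : r ≤ j) :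
    mu.rowLen r < lam.rowLen r := by
  rcases hj.lt_or_eq with hr | rfl
  · have h2 := h.inside r hi hr
    have h3 := lam.rowLen_anti r (r + 1) (by omega)
    omega
  · exact h.last_lt

theorem connectedCells (h : IsRimStrip ℓ lam mu i j) :
    ConnectedCells (lam.cells \ mu.cells) := by
  set s := lam.cells \ mu.cells with hs
  let R : ℕ × ℕ → ℕ × ℕ → Prop := fun x y => x ∈ s ∧ y ∈ s ∧ AdjCell x y
  have : Std.Symm R := ⟨by
    rintro x y ⟨hx, hy, hxy⟩
    refine ⟨hy, hx, ?_⟩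
    unfold AdjCell at hxy ⊢
    omega⟩
  have hrow : ∀ a b n, mu.rowLen a ≤ b → b + n < lam.rowLen a →
      Relation.ReflTransGen R (a, b) (a, b + n) := by
    intro a b n hb
    induction n with
    | zero => intro _; exact .refl
    | succ n ih =>
      intro hn
      refine (ih (by omega)).tail ⟨mem_sdiff_cells.2 (by omega), mem_sdiff_cells.2 (by omega), ?_⟩
      exact Or.inl ⟨rfl, Or.inr rfl⟩
  have hlast : ∀ a b, (a, b) ∈ s → Relation.ReflTransGen R (a, b) (a, lam.rowLen a - 1) := by
    intro a b hab
    rw [hs, mem_sdiff_cells] at hab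
    have := hrow a b (lam.rowLen a - 1 - b) (by omega) (by omega)
    rwa [Nat.add_sub_cancel' (by omega)] at this
  have hup : ∀ a, i ≤ a → a ≤ j →
      Relation.ReflTransGen R (a, lam.rowLen a - 1) (i, lam.rowLen i - 1) := by
    intro a ha
    induction a, ha using Nat.le_induction with
    | base => intro _; exact .refl
    | succ a ha ih =>
      intro haj
      have h1 := h.inside a ha (by omega)
      have h2 := h.rowLen_lt (r := a + 1) (by omega) haj
      have h3 := h.rowLen_lt (r := a) ha (by omega)
      have hm : (a, lam.rowLen (a + 1) - 1) ∈ s :=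
        mem_sdiff_cells.2 (by have := lam.rowLen_anti a (a + 1) (by omega); omega)
      refine .head ⟨mem_sdiff_cells.2 (by omega), hm, ?_⟩ ((hlast _ _ hm).trans (ih (by omega)))
      exact Or.inr ⟨rfl, Or.inl rfl⟩
  have hall : ∀ p ∈ s, Relation.ReflTransGen R p (i, lam.rowLen i - 1) := by
    rintro ⟨a, b⟩ hp
    obtain ⟨h1, h2⟩ := h.row_mem hp
    exact (hlast a b hp).trans (hup a h1 h2)
  intro p hp q hq
  exact (hall p hp).trans (symm_of (Relation.ReflTransGen R) (hall q hq))

theorem isRemovableRimHook (h : IsRimStrip ℓ lam mu i j) :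
    IsRemovableRimHook ℓ lam (lam.cells \ mu.cells) := by
  refine ⟨mu, h.cells_subset, rfl, ?_, h.connectedCells, ?_⟩
  · have := card_sdiff_of_rows h.le h.outside h.inside h.last_lt
    have := h.size
    omega
  · rintro ⟨a, b, h1, h2, h3, h4⟩
    have ha := h.row_mem h1
    have hb := h.row_mem h2
    have := h.inside a (by omega) (by omega)
    rw [mem_sdiff_cells] at h1 h4
    omega

theorem horizontalCells_iff (h : IsRimStrip ℓ lam mu i j) :
    HorizontalCells (lam.cells \ mu.cells) ↔ i = j := by
  constructor
  · intro hh
    have h1 := h.rowLen_lt le_rfl h.le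
    have h2 := h.last_lt
    exact hh (i, mu.rowLen i) (mem_sdiff_cells.2 (by omega)) (j, mu.rowLen j)
      (mem_sdiff_cells.2 (by omega))
  · rintro rfl ⟨a, b⟩ hp ⟨c, d⟩ hq
    have h1 := h.row_mem hp
    have h2 := h.row_mem hq
    simp only
    omega

theorem bead_outside (h : IsRimStrip ℓ lam mu i j) {r : ℕ} (hr : r < i ∨ j < r) :
    mu.bead r = lam.bead r := by
  rw [bead, bead, h.outside r hr]

theorem bead_inside (h : IsRimStrip ℓ lam mu i j) {r : ℕ} (hi : i ≤ r) (hj : r < j) :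
    mu.bead r = lam.bead (r + 1) := by
  have := h.inside r hi hj
  unfold bead
  omega

theorem bead_last (h : IsRimStrip ℓ lam mu i j) : mu.bead j = lam.bead i - ℓ := by
  have := h.size
  unfold bead
  omega

theorem bead_last_lt (h : IsRimStrip ℓ lam mu i j) : lam.bead i - ℓ < lam.bead j := by
  rw [← h.bead_last]
  have := h.last_lt
  unfold bead
  omega

theorem lt_bead_last (h : IsRimStrip ℓ lam mu i j) : lam.bead (j + 1) < lam.bead i - ℓ := by
  rw [← h.bead_last, ← h.bead_outside (r := j + 1) (by omega)]
  exact mu.bead_strictAnti (by omega)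

theorem notMem_beads (h : IsRimStrip ℓ lam mu i j) : lam.bead i - ℓ ∉ lam.beads :=
  notMem_beads_of_between h.bead_last_lt h.lt_bead_last

theorem mem_beads_iff (h : IsRimStrip ℓ lam mu i j) (z : ℤ) :
    z ∈ mu.beads ↔ z = lam.bead i - ℓ ∨ (z ∈ lam.beads ∧ z ≠ lam.bead i) := by
  constructor
  · rintro ⟨r, rfl⟩
    by_cases hout : r < i ∨ j < r
    · rw [h.bead_outside hout]
      refine Or.inr ⟨lam.bead_mem r, fun he => ?_⟩
      have := lam.bead_strictAnti.injective he
      have := h.le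
      omega
    · rcases (show r ≤ j by omega).lt_or_eq with hr | rfl
      · rw [h.bead_inside (by omega) hr]
        refine Or.inr ⟨lam.bead_mem _, fun he => ?_⟩
        have := lam.bead_strictAnti.injective he
        omega
      · exact Or.inl h.bead_last
  · rintro (rfl | ⟨⟨r, rfl⟩, hr⟩)
    · exact ⟨j, h.bead_last⟩
    · by_cases hout : r < i ∨ j < r
      · exact ⟨r, h.bead_outside hout⟩
      · have hri : r ≠ i := fun he => hr (by rw [he])
        refine ⟨r - 1, ?_⟩
        rw [h.bead_inside (by omega) (by omega), Nat.sub_add_cancel (by omega)]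

theorem eq_iff_forall_notMem (h : IsRimStrip ℓ lam mu i j) :
    i = j ↔ ∀ u, lam.bead i - ℓ < u → u < lam.bead i → u ∉ lam.beads := by
  constructor
  · rintro rfl u h1 h2
    exact notMem_beads_of_between h2 (h.lt_bead_last.trans h1)
  · intro hu
    by_contra hij
    refine hu _ h.bead_last_lt (lam.bead_strictAnti ?_) (lam.bead_mem j)
    have := h.le
    omega

end IsRimStrip

theorem exists_isRimStrip_of_notMem {ℓ : ℕ} (hℓ : 0 < ℓ) {lam : YoungDiagram} {i : ℕ}
    (h : lam.bead i - ℓ ∉ lam.beads) : ∃ mu j, IsRimStrip ℓ lam mu i j := by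
  obtain ⟨j, hij, hj, hj'⟩ := lam.exists_last_bead_gt (i := i) (z := lam.bead i - ℓ) (by omega)
  have hj'' : lam.bead (j + 1) < lam.bead i - ℓ :=
    lt_of_le_of_ne hj' fun he => h (he ▸ lam.bead_mem _)
  have hanti := fun r => lam.rowLen_anti r (r + 1) (by omega)
  have hanti' := lam.rowLen_anti i j hij
  unfold bead at hj hj''
  let f : ℕ → ℕ := fun r => if r < i ∨ j < r then lam.rowLen r
    else if r = j then lam.rowLen i + j - i - ℓ else lam.rowLen (r + 1) - 1
  have hf : Antitone f := by
    refine antitone_nat_of_succ_le fun r => ?_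
    have h1 := hanti r
    have h2 := hanti (r + 1)
    simp only [f]
    by_cases h3 : r + 1 = i
    · subst h3
      split_ifs <;> omega
    · by_cases h4 : r = j
      · subst h4
        split_ifs <;> omega
      · by_cases h5 : r + 1 = j
        · subst h5
          split_ifs <;> omega
        · split_ifs <;> omega
  obtain ⟨N, hN⟩ := lam.exists_rowLen_eq_zero
  obtain ⟨mu, hmu⟩ := exists_rowLen_eq hf (N := N + j + 1) (by
    have := lam.rowLen_anti N (N + j + 1) (by omega)
    simp only [f]
    split_ifs <;> omega)
  refine ⟨mu, j, hij, fun r hr => ?_, fun r hi hj => ?_, ?_, ?_⟩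
  · rw [hmu]; simp only [f]; rw [if_pos hr]
  · rw [hmu]
    have := lam.rowLen_anti (r + 1) j hj
    simp only [f]
    split_ifs <;> omega
  · rw [hmu]; simp only [f]; split_ifs <;> omega
  · rw [hmu]; simp only [f]; split_ifs <;> omega

theorem exists_isRimStrip_of_isRemovableRimHook {ℓ : ℕ} (hℓ : 0 < ℓ) {lam : YoungDiagram}
    {s : Finset (ℕ × ℕ)} (h : IsRemovableRimHook ℓ lam s) :
    ∃ mu i j, s = lam.cells \ mu.cells ∧ IsRimStrip ℓ lam mu i j := by
  obtain ⟨mu, hsub, rfl, hcard, hconn, hsq⟩ := h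
  set s := lam.cells \ mu.cells with hs
  have hle : ∀ r, mu.rowLen r ≤ lam.rowLen r := by
    intro r
    by_contra! hr
    have := hsub (mem_cells (r, lam.rowLen r) |>.2 (mem_iff_lt_rowLen.2 hr))
    rw [mem_cells, mem_iff_lt_rowLen] at this
    omega
  have hne : (s.image Prod.fst).Nonempty := by
    rw [Finset.image_nonempty, ← Finset.card_pos]
    omega
  obtain ⟨⟨i, b⟩, hib, hi⟩ := Finset.mem_image.1 ((s.image Prod.fst).min'_mem hne)
  obtain ⟨⟨j, d⟩, hjd, hj⟩ := Finset.mem_image.1 ((s.image Prod.fst).max'_mem hne)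
  have himin : ∀ a c, (a, c) ∈ s → i ≤ a := fun a c hac =>
    hi.trans_le (Finset.min'_le _ _ (Finset.mem_image_of_mem Prod.fst hac))
  have hjmax : ∀ a c, (a, c) ∈ s → a ≤ j := fun a c hac =>
    (Finset.le_max' _ _ (Finset.mem_image_of_mem Prod.fst hac)).trans_eq hj.symm
  have hij : i ≤ j := himin _ _ hjd
  have hout : ∀ r, r < i ∨ j < r → mu.rowLen r = lam.rowLen r := by
    intro r hr
    by_contra hc
    have hm : (r, mu.rowLen r) ∈ s := mem_sdiff_cells.2 (by have := hle r; omega)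
    have h1 := himin _ _ hm
    have h2 := hjmax _ _ hm
    omega
  have hcross : ∀ r, i ≤ r → r < j → ∃ c, (r, c) ∈ s ∧ (r + 1, c) ∈ s := by
    intro r hir hrj
    by_contra! hc
    have hstay : ∀ q, Relation.ReflTransGen (fun x y => x ∈ s ∧ y ∈ s ∧ AdjCell x y) (i, b) q →
        q.1 ≤ r := by
      intro q hq
      induction hq with
      | refl => exact hir
      | @tail x y _ hxy ih =>
        obtain ⟨x1, x2⟩ := x
        obtain ⟨y1, y2⟩ := y
        obtain ⟨hx, hy, hadj⟩ := hxy
        by_contra! hlt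
        simp only [AdjCell] at hadj ih hlt
        have hx1 : x1 = r := by omega
        have hy1 : y1 = r + 1 := by omega
        have hy2 : y2 = x2 := by omega
        subst hx1 hy1 hy2
        exact hc _ hx hy
    have := hstay _ (hconn _ hib _ hjd)
    simp only at this
    omega
  have hin : ∀ r, i ≤ r → r < j → mu.rowLen r + 1 = lam.rowLen (r + 1) := by
    intro r hir hrj
    obtain ⟨c, h1, h2⟩ := hcross r hir hrj
    rw [hs, mem_sdiff_cells] at h1 h2
    by_contra hc
    have h3 := lam.rowLen_anti r (r + 1) (by omega)
    have h4 := mu.rowLen_anti r (r + 1) (by omega)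
    refine hsq ⟨r, mu.rowLen r, ?_, ?_, ?_, ?_⟩ <;> exact mem_sdiff_cells.2 (by omega)
  have hlast : mu.rowLen j < lam.rowLen j := by
    have := mem_sdiff_cells.1 hjd
    omega
  refine ⟨mu, i, j, hs, hij, hout, hin, hlast, ?_⟩
  have := card_sdiff_of_rows hij hout hin hlast
  rw [← hs] at this
  omega

end YoungDiagram

/-- Carter's condition in terms of a Maya diagram: whether the distance from a gap to a bead
above it is divisible by `ℓ` depends only on the gap. -/
def BeadStar (ℓ : ℕ) (S : Set ℤ) : Prop :=
  ∀ g ∉ S, ∀ t ∈ S, ∀ u ∈ S, g < t → g < u → (ℓ : ℤ) ∣ t - g → (ℓ : ℤ) ∣ u - g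

open YoungDiagram

theorem BeadStar.of_isRimStrip {ℓ : ℕ} {lam mu : YoungDiagram} {i j : ℕ}
    (hS : BeadStar ℓ lam.beads) (h : IsRimStrip ℓ lam mu i j) : BeadStar ℓ mu.beads := by
  set b := lam.bead i with hb
  have hbm : b ∈ lam.beads := lam.bead_mem i
  have hlt : b - ℓ < b := h.bead_last_lt.trans_le (lam.bead_strictAnti.antitone h.le)
  have hlift : ∀ g, g ∉ mu.beads → ∀ t ∈ mu.beads, g < t →
      ∃ t' ∈ lam.beads, g < t' ∧ (ℓ : ℤ) ∣ t' - t := by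
    intro g _ t ht hgt
    rcases (h.mem_beads_iff t).1 ht with rfl | ⟨ht, -⟩
    · exact ⟨b, hbm, hgt.trans hlt, by simp [← hb]⟩
    · exact ⟨t, ht, hgt, by simp⟩
  intro g hg t ht u hu hgt hgu htg
  obtain ⟨t', ht', hgt', hdt⟩ := hlift g hg t ht hgt
  obtain ⟨u', hu', hgu', hdu⟩ := hlift g hg u hu hgu
  rw [h.mem_beads_iff] at hg
  push Not at hg
  have key : (ℓ : ℤ) ∣ u' - g := by
    by_cases hgb : g = b
    · subst hgb
      have := hS (b - ℓ) h.notMem_beads b hbm u' hu' hlt (by omega) (by simp)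
      have h2 : u' - b = u' - (b - ℓ) - ℓ := by ring
      rw [h2]
      exact dvd_sub_self_right.2 this
    · refine hS g (fun hm => hgb (hg.2 hm)) t' ht' u' hu' hgt' hgu' ?_
      rw [← sub_add_sub_cancel t' t g]
      exact dvd_add hdt htg
  have h2 : u' - g - (u' - u) = u - g := by ring
  simpa [h2] using dvd_sub key hdu

theorem BeadStar.not_between {ℓ : ℕ} {S : Set ℤ} (hS : BeadStar ℓ S) {t u : ℤ}
    (ht : t ∈ S) (htℓ : t - ℓ ∉ S) (h1 : t - ℓ < u) (h2 : u < t) : u ∉ S := by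
  intro hu
  have h3 := hS _ htℓ t ht u hu (by omega) h1 (by simp)
  have := Int.le_of_dvd (by omega) h3
  omega

theorem regular_of_beadStar {ℓ : ℕ} (hℓ : 2 ≤ ℓ) {lam : YoungDiagram}
    (hS : BeadStar ℓ lam.beads) : Regular ℓ lam := by
  classical
  intro i hi
  by_contra hpos
  have hex := lam.exists_rowLen_eq_zero
  have hspec := Nat.find_spec hex
  have hmin := fun {m} => Nat.find_min hex (m := m)
  set N := Nat.find hex with hN
  have hiN : i + ℓ - 1 < N := by
    by_contra! hc
    have := lam.rowLen_anti _ _ hc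
    omega
  have hlast := hmin (m := N - 1) (by omega)
  have hgap : -(N : ℤ) ∉ lam.beads := by
    refine notMem_beads_of_between (i := N - 1) ?_ ?_
    · unfold bead
      omega
    · rw [Nat.sub_add_cancel (by omega)]
      unfold bead
      omega
  have hrun : ∀ r : ℕ, r < ℓ → lam.bead i - r ∈ lam.beads := by
    intro r hr
    refine ⟨i + r, ?_⟩
    have h1 := lam.rowLen_anti i (i + r) (by omega)
    have h2 := lam.rowLen_anti (i + r) (i + ℓ - 1) (by omega)
    unfold bead
    omega
  have hgt : ∀ r : ℕ, r < ℓ → -(N : ℤ) < lam.bead i - r := by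
    intro r hr
    unfold bead
    omega
  have hr := Int.emod_nonneg (lam.bead i + N) (b := ℓ) (by omega)
  have hr' := Int.emod_lt_of_pos (lam.bead i + N) (b := ℓ) (by omega)
  obtain ⟨r, hre⟩ := Int.eq_ofNat_of_zero_le hr
  have hrℓ : r < ℓ := by omega
  have hd : (ℓ : ℤ) ∣ lam.bead i - r - -(N : ℤ) := by
    have := Int.dvd_self_sub_emod (x := lam.bead i + N) (m := ℓ)
    rw [hre] at this
    rwa [sub_neg_eq_add, sub_add_eq_add_sub]
  obtain ⟨q, hqℓ, hqr, hq⟩ : ∃ q : ℕ, q < ℓ ∧ q ≠ r ∧ ((q : ℤ) - r = 1 ∨ (q : ℤ) - r = -1) := by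
    by_cases h : r + 1 < ℓ
    · exact ⟨r + 1, h, by omega, by omega⟩
    · exact ⟨r - 1, by omega, by omega, by omega⟩
  have hd' := hS _ hgap _ (hrun r hrℓ) _ (hrun q hqℓ) (hgt r hrℓ) (hgt q hqℓ) hd
  have h1 : (ℓ : ℤ) ∣ (q : ℤ) - r := by
    have h := dvd_sub hd hd'
    rwa [sub_sub_sub_cancel_right, sub_sub_sub_cancel_left] at h
  have h2 : (ℓ : ℤ) ∣ 1 := by
    rcases hq with hq | hq
    · rwa [hq] at h1
    · rwa [hq, dvd_neg] at h1
  have := Int.le_of_dvd (by norm_num) h2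
  omega

/-- On a runner of the abacus having a bead above a gap, some bead can be slid down by `ℓ`. -/
theorem exists_movable_bead {ℓ : ℕ} (hℓ : 0 < ℓ) {S : Set ℤ} {g t : ℤ} (hg : g ∉ S) (ht : t ∈ S)
    (hgt : g < t) (hd : (ℓ : ℤ) ∣ t - g) :
    ∃ b ∈ S, b - ℓ ∉ S ∧ g ≤ b - ℓ ∧ b ≤ t ∧ (ℓ : ℤ) ∣ b - g := by
  obtain ⟨n, hn⟩ := hd
  have hn0 : 0 < n := by
    by_contra! hc
    have := mul_nonpos_of_nonneg_of_nonpos (Int.natCast_nonneg ℓ) hc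
    omega
  lift n to ℕ using hn0.le
  induction n generalizing t with
  | zero => simp at hn0
  | succ n ih =>
    push_cast at hn
    by_cases hm : t - ℓ ∈ S
    · have hn' : t - ℓ - g = ℓ * n := by linarith
      have hn1 : n ≠ 0 := by
        rintro rfl
        have : t - ℓ = g := by simp at hn'; omega
        exact hg (this ▸ hm)
      have hpos : (0 : ℤ) < ℓ * n := by positivity
      obtain ⟨b, hb, hbℓ, hgb, hbt, hd⟩ := ih hm (by omega) hn' (by omega)
      exact ⟨b, hb, hbℓ, hgb, by omega, hd⟩
    · have : (0 : ℤ) ≤ ℓ * n := by positivity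
      exact ⟨t, ht, hm, by linarith, le_rfl, ⟨n + 1, hn⟩⟩

/-- All rim hooks met while repeatedly removing horizontal rim hooks are horizontal. -/
def OnlyHorizHooks (ℓ : ℕ) (lam : YoungDiagram) : Prop :=
  ∀ μ : YoungDiagram, Relation.ReflTransGen (RemoveHorizHook ℓ) lam μ →
    ∀ s, IsRemovableRimHook ℓ μ s → HorizontalCells s

theorem OnlyHorizHooks.slide {ℓ : ℕ} (hℓ : 0 < ℓ) {lam : YoungDiagram} (h : OnlyHorizHooks ℓ lam)
    {b : ℤ} (hb : b ∈ lam.beads) (hbℓ : b - ℓ ∉ lam.beads) :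
    (∀ u, b - ℓ < u → u < b → u ∉ lam.beads) ∧
      ∃ mu : YoungDiagram, OnlyHorizHooks ℓ mu ∧ mu.cells.card < lam.cells.card ∧
        ∀ z, z ∈ mu.beads ↔ z = b - ℓ ∨ (z ∈ lam.beads ∧ z ≠ b) := by
  obtain ⟨i, rfl⟩ := hb
  obtain ⟨mu, j, hst⟩ := exists_isRimStrip_of_notMem hℓ hbℓ
  have hrim := hst.isRemovableRimHook
  have hhor := h lam .refl _ hrim
  refine ⟨hst.eq_iff_forall_notMem.1 (hst.horizontalCells_iff.1 hhor), mu, ?_, ?_,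
    hst.mem_beads_iff⟩
  · have hstep : RemoveHorizHook ℓ lam mu :=
      ⟨_, hrim, hhor, by rw [Finset.sdiff_sdiff_eq_self hst.cells_subset]⟩
    exact fun nu hnu => h nu (.head hstep hnu)
  · obtain ⟨-, -, -, hcard, -⟩ := hrim
    rw [Finset.card_sdiff_of_subset hst.cells_subset] at hcard
    omega

theorem OnlyHorizHooks.beadStar {ℓ : ℕ} (hℓ : 0 < ℓ) {lam : YoungDiagram}
    (h : OnlyHorizHooks ℓ lam) : BeadStar ℓ lam.beads := by
  induction hn : lam.cells.card using Nat.strong_induction_on generalizing lam with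
  | _ n ih =>
  subst hn
  intro g hg t ht u hu hgt hgu hdt
  by_contra hdu
  obtain ⟨b, hb, hbℓ, hgb, hbt, hdb⟩ := exists_movable_bead hℓ hg ht hgt hdt
  obtain ⟨hbet, mu, hmu, hcard, hbeads⟩ := h.slide hℓ hb hbℓ
  have hmuS := ih _ hcard hmu rfl
  have hub : u ≠ b := fun he => hdu (he ▸ hdb)
  rcases hgb.lt_or_eq with hlt | heq
  · refine hdu (hmuS g ?_ (b - ℓ) ((hbeads _).2 (Or.inl rfl)) u ((hbeads _).2 (Or.inr ⟨hu, hub⟩))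
      hlt hgu ?_)
    · rw [hbeads]
      rintro (he | ⟨hm, -⟩)
      · omega
      · exact hg hm
    · rw [sub_right_comm]
      exact dvd_sub_self_right.2 hdb
  · have hbg : b = g + ℓ := by omega
    have hmod := Int.emod_nonneg (u - g) (b := ℓ) (by omega)
    have hmod' := Int.emod_lt_of_pos (u - g) (b := ℓ) (by omega)
    have hmod0 : (u - g) % ℓ ≠ 0 := fun h0 => hdu (Int.dvd_of_emod_eq_zero h0)
    have hgub : b < u := by
      by_contra! hc
      exact hbet u (by omega) (by omega) hu
    obtain ⟨c, hc, hcℓ, hgc, -, hdc⟩ := exists_movable_bead hℓ (g := g + (u - g) % ℓ)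
      (hbet _ (by omega) (by omega)) hu (by omega)
      (by rw [← sub_sub]; exact Int.dvd_self_sub_emod)
    obtain ⟨hbet', nu, hnu, hcard', hbeads'⟩ := h.slide hℓ hc hcℓ
    have hbc : b < c - ℓ := by
      by_contra! hle
      rcases hle.lt_or_eq with hlt | heq
      · exact hbet' b hlt (by omega) hb
      · exact hcℓ (heq ▸ hb)
    have hnuS := ih _ hcard' hnu rfl
    have hdc' : (ℓ : ℤ) ∣ c - ℓ - g := by
      refine hnuS g ?_ b ((hbeads' _).2 (Or.inr ⟨hb, by omega⟩)) (c - ℓ)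
        ((hbeads' _).2 (Or.inl rfl)) (by omega) (by omega) (by simp [hbg])
      rw [hbeads']
      rintro (he | ⟨hm, -⟩)
      · omega
      · exact hg hm
    have hfin : (ℓ : ℤ) ∣ (u - g) % ℓ := by
      have h1 := dvd_sub (dvd_add hdc' (dvd_refl (ℓ : ℤ))) hdc
      rwa [show c - ℓ - g + ℓ - (c - (g + (u - g) % ℓ)) = (u - g) % ℓ by ring] at h1
    have := Int.le_of_dvd (by omega) hfin
    omega

theorem isEllPartition_iff_beadStar {ℓ : ℕ} (hℓ : 2 ≤ ℓ) (lam : YoungDiagram) :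
    IsEllPartition ℓ lam ↔ BeadStar ℓ lam.beads := by
  refine ⟨fun h => OnlyHorizHooks.beadStar (by omega) h.2, fun h => ⟨regular_of_beadStar hℓ h, ?_⟩⟩
  intro mu hmu
  have hS : BeadStar ℓ mu.beads := by
    induction hmu with
    | refl => exact h
    | tail _ hstep ih =>
      obtain ⟨s, hs, -, hcells⟩ := hstep
      obtain ⟨nu, i, j, rfl, hst⟩ := exists_isRimStrip_of_isRemovableRimHook (by omega) hs
      rw [Finset.sdiff_sdiff_eq_self hst.cells_subset] at hcells
      rw [YoungDiagram.ext hcells]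
      exact ih.of_isRimStrip hst
  intro s hs
  obtain ⟨nu, i, j, rfl, hst⟩ := exists_isRimStrip_of_isRemovableRimHook (by omega) hs
  exact hst.horizontalCells_iff.2 (hst.eq_iff_forall_notMem.2 fun u h1 h2 =>
    hS.not_between (mu.bead_mem i) hst.notMem_beads h1 h2)

/-- The hook lengths in the first row of `lam`. -/
def firstHooks (lam : YoungDiagram) : Finset ℕ :=
  (Finset.range (lam.rowLen 0)).image (hookLen lam 0)

theorem mem_firstHooks {lam : YoungDiagram} {h : ℕ} :
    h ∈ firstHooks lam ↔ 0 < h ∧ lam.bead 0 - h ∉ lam.beads := by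
  simp only [firstHooks, Finset.mem_image, Finset.mem_range, hookLen]
  constructor
  · rintro ⟨c, hc, rfl⟩
    have h0 := mem_iff_lt_colLen.1 (mem_iff_lt_rowLen.2 hc)
    refine ⟨by omega, ?_⟩
    rintro ⟨r, hr⟩
    have hiff : r < lam.colLen c ↔ c < lam.rowLen r := by
      rw [← mem_iff_lt_colLen, ← mem_iff_lt_rowLen]
    unfold bead at hr
    omega
  · rintro ⟨hpos, hgap⟩
    obtain ⟨r, -, hr, hr'⟩ := lam.exists_last_bead_gt (i := 0) (z := lam.bead 0 - h) (by omega)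
    have hr'' := lt_of_le_of_ne hr' fun he => hgap (he ▸ lam.bead_mem _)
    have h1 := lam.rowLen_anti 0 r (by omega)
    unfold bead at hr hr''
    push_cast at hr''
    obtain ⟨c, hc⟩ := Int.eq_ofNat_of_zero_le (a := lam.rowLen 0 - h + r) (by omega)
    have h2 : r < lam.colLen c ↔ c < lam.rowLen r := by
      rw [← mem_iff_lt_colLen, ← mem_iff_lt_rowLen]
    have h3 : r + 1 < lam.colLen c ↔ c < lam.rowLen (r + 1) := by
      rw [← mem_iff_lt_colLen, ← mem_iff_lt_rowLen]
    exact ⟨c, by omega, by omega⟩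

theorem sub_mem_beads_iff {lam : YoungDiagram} {y : ℕ} :
    lam.bead 0 - y ∈ lam.beads ↔ y ∉ firstHooks lam := by
  rw [mem_firstHooks, not_and, not_not]
  refine ⟨fun h _ => h, fun h => ?_⟩
  rcases y.eq_zero_or_pos with rfl | hy
  · simpa using lam.bead_mem 0
  · exact h hy

theorem zero_notMem_firstHooks (lam : YoungDiagram) : 0 ∉ firstHooks lam := by
  simp [mem_firstHooks]

theorem card_firstHooks (lam : YoungDiagram) : (firstHooks lam).card = lam.rowLen 0 := by
  rw [firstHooks, Finset.card_image_of_injOn, Finset.card_range]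
  intro c hc d hd h
  rw [Finset.mem_coe, Finset.mem_range] at hc hd
  have hc' := mem_iff_lt_colLen.1 (mem_iff_lt_rowLen.2 hc)
  have hd' := mem_iff_lt_colLen.1 (mem_iff_lt_rowLen.2 hd)
  simp only [hookLen] at h
  rcases lt_trichotomy c d with hlt | rfl | hlt
  · have := lam.colLen_anti c d hlt.le
    omega
  · rfl
  · have := lam.colLen_anti d c hlt.le
    omega

theorem firstHooks_injective : Function.Injective firstHooks := by
  intro lam mu h
  have hrow : lam.bead 0 = mu.bead 0 := by
    have := congrArg Finset.card h
    rw [card_firstHooks, card_firstHooks] at this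
    simp [bead, this]
  apply beads_injective
  ext z
  by_cases hz : z ≤ lam.bead 0
  · obtain ⟨y, hy⟩ := Int.eq_ofNat_of_zero_le (sub_nonneg.2 hz)
    obtain rfl : z = lam.bead 0 - y := by omega
    rw [sub_mem_beads_iff, h, hrow, sub_mem_beads_iff]
  · exact iff_of_false (fun hm => hz (le_bead_zero hm))
      (fun hm => hz (hrow ▸ le_bead_zero hm))

theorem exists_firstHooks_eq {Y : Finset ℕ} (hY : 0 ∉ Y) : ∃ lam, firstHooks lam = Y := by
  classical
  have hinf : Set.Infinite {n | n ∉ Y} := Y.finite_toSet.infinite_compl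
  set y := Nat.nth fun n => n ∉ Y with hy
  have hmono : StrictMono y := Nat.nth_strictMono hinf
  have hbelow : ∀ i, i + (Y.filter (· < y i)).card = y i := by
    intro i
    have h1 : ((Finset.range (y i)).filter fun n => n ∉ Y).card = i := by
      rw [← Nat.count_eq_card_filter_range]
      exact Nat.count_nth_of_infinite hinf i
    have h2 := Finset.card_filter_add_card_filter_not (s := Finset.range (y i)) (fun n => n ∉ Y)
    rw [h1, Finset.card_range] at h2
    convert h2 using 3
    ext n
    simp [and_comm]
  have hmem : ∀ n, (∃ i, y i = n) ↔ n ∉ Y := fun n =>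
    Set.ext_iff.1 (Nat.range_nth_of_infinite hinf) n
  have hy0 : y 0 = 0 := by
    obtain ⟨i, hi⟩ := (hmem 0).2 hY
    have := hmono.monotone (Nat.zero_le i)
    omega
  have hle : ∀ i, (Y.filter (· < y i)).card ≤ Y.card := fun i => Finset.card_filter_le _ _
  obtain ⟨lam, hlam⟩ := exists_rowLen_eq (f := fun i => Y.card - (Y.filter (· < y i)).card)
    (fun i j hij => Nat.sub_le_sub_left (Finset.card_le_card fun n hn => by
      rw [Finset.mem_filter] at hn ⊢
      exact ⟨hn.1, hn.2.trans_le (hmono.monotone hij)⟩) _)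
    (N := Y.sup id + 1) (by
      rw [Finset.filter_true_of_mem, Nat.sub_self]
      intro n hn
      have h1 := Finset.le_sup (f := id) hn
      have h2 := hmono.le_apply (x := Y.sup id + 1)
      simp only [id] at h1
      omega)
  have hbead : ∀ i, lam.bead i = Y.card - y i - 1 := by
    intro i
    have := hbelow i
    have := hle i
    rw [bead, hlam]
    omega
  refine ⟨lam, Finset.ext fun n => not_iff_not.1 ?_⟩
  rw [← sub_mem_beads_iff, ← hmem, hbead, hy0]
  refine exists_congr fun i => ?_
  rw [hbead]
  omega

/-- Carter's condition in terms of the set of hook lengths in the first row. -/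
def HookStar (ℓ : ℕ) (Y : Finset ℕ) : Prop :=
  ∀ h ∈ Y, ∀ y < h, (ℓ ∣ h → ¬ ℓ ∣ y → y ∈ Y) ∧ (¬ ℓ ∣ h → ℓ ∣ h - y → y ∈ Y)

theorem beadStar_iff_hookStar {ℓ : ℕ} {lam : YoungDiagram} :
    BeadStar ℓ lam.beads ↔ HookStar ℓ (firstHooks lam) := by
  constructor
  · intro hS h hh y hy
    have hgap := (mem_firstHooks.1 hh).2
    have hd : lam.bead 0 - (lam.bead 0 - h) = (h : ℤ) := by ring
    have hd' : lam.bead 0 - y - (lam.bead 0 - h) = ((h - y : ℕ) : ℤ) := by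
      rw [Nat.cast_sub hy.le]
      ring
    constructor
    · intro hdvd hndvd
      by_contra hyY
      have := hS _ hgap _ (lam.bead_mem 0) _ (sub_mem_beads_iff.2 hyY) (by omega) (by omega)
        (by rw [hd]; exact_mod_cast hdvd)
      rw [hd', Int.natCast_dvd_natCast] at this
      exact hndvd ((Nat.dvd_sub_iff_right hy.le hdvd).1 this)
    · intro hndvd hdvd
      by_contra hyY
      have := hS _ hgap _ (sub_mem_beads_iff.2 hyY) _ (lam.bead_mem 0) (by omega) (by omega)
        (by rw [hd']; exact_mod_cast hdvd)
      rw [hd, Int.natCast_dvd_natCast] at this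
      exact hndvd this
  · intro hS g hg t ht u hu hgt hgu hd
    obtain ⟨a, ha⟩ := Int.eq_ofNat_of_zero_le (sub_nonneg.2 (le_bead_zero ht))
    obtain ⟨b, hb⟩ := Int.eq_ofNat_of_zero_le (sub_nonneg.2 (le_bead_zero hu))
    obtain ⟨h, hh⟩ := Int.eq_ofNat_of_zero_le (a := lam.bead 0 - g) (by omega)
    obtain rfl : t = lam.bead 0 - a := by omega
    obtain rfl : u = lam.bead 0 - b := by omega
    obtain rfl : g = lam.bead 0 - h := by omega
    rw [sub_mem_beads_iff] at ht hu
    have hhY : h ∈ firstHooks lam := mem_firstHooks.2 ⟨by omega, hg⟩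
    have hah : a < h := by omega
    have hbh : b < h := by omega
    rw [sub_sub_sub_cancel_left, ← Nat.cast_sub hah.le, Int.natCast_dvd_natCast] at hd
    rw [sub_sub_sub_cancel_left, ← Nat.cast_sub hbh.le, Int.natCast_dvd_natCast]
    have hdh : ℓ ∣ h := by
      by_contra hc
      exact ht ((hS h hhY a hah).2 hc hd)
    by_contra hc
    refine hu ((hS h hhY b hbh).1 hdh fun hdb => hc (Nat.dvd_sub hdh hdb))

/-- Pairs `(n, Z)` describing the sets satisfying `HookStar`: `n i` counts the elements congruent
to `i + 1`, and `Z` records the multiples of `ℓ`. -/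
abbrev AbacusData (ℓ : ℕ) : Type :=
  {p : (Fin (ℓ - 1) → ℕ) × Finset ℕ // ∀ z ∈ p.2, ∀ i, z < p.1 i}

/-- The weight of a pair `(n, Z)`. -/
def abacusWeight {ℓ : ℕ} (p : AbacusData ℓ) : ℕ := ∑ i, p.1.1 i + p.1.2.card

/-- The set of hook lengths described by a pair `(n, Z)`. -/
def hooksOf (ℓ : ℕ) (p : (Fin (ℓ - 1) → ℕ) × Finset ℕ) : Finset ℕ :=
  p.2.image (fun z => ℓ * (z + 1)) ∪
    Finset.univ.biUnion fun i => (Finset.range (p.1 i)).image fun m => ℓ * m + (i + 1)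

section hooksOf

variable {ℓ : ℕ} {p : (Fin (ℓ - 1) → ℕ) × Finset ℕ}

theorem not_dvd_mul_add_succ (i : Fin (ℓ - 1)) (m : ℕ) : ¬ ℓ ∣ ℓ * m + (i + 1) := by
  rw [Nat.dvd_add_right (dvd_mul_right ℓ m)]
  have := i.isLt
  exact Nat.not_dvd_of_pos_of_lt (by omega) (by omega)

theorem eq_of_mul_add_succ_eq {i j : Fin (ℓ - 1)} {m n : ℕ}
    (h : ℓ * m + (i + 1) = ℓ * n + (j + 1)) : i = j ∧ m = n := by
  have hi := i.isLt
  have hj := j.isLt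
  have h1 := congrArg (· % ℓ) h
  simp only [Nat.mul_add_mod] at h1
  rw [Nat.mod_eq_of_lt (by omega), Nat.mod_eq_of_lt (by omega)] at h1
  refine ⟨Fin.ext (by omega), ?_⟩
  have h2 : ℓ * m = ℓ * n := by omega
  exact Nat.eq_of_mul_eq_mul_left (by omega) h2

theorem exists_eq_mul_add_succ {x : ℕ} (hℓ : 0 < ℓ) (h : ¬ ℓ ∣ x) :
    ∃ (i : Fin (ℓ - 1)) (m : ℕ), x = ℓ * m + (i + 1) := by
  have h1 := Nat.mod_lt x hℓ
  have h2 : x % ℓ ≠ 0 := fun h0 => h (Nat.dvd_of_mod_eq_zero h0)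
  refine ⟨⟨x % ℓ - 1, by omega⟩, x / ℓ, ?_⟩
  have := Nat.div_add_mod x ℓ
  simp only
  omega

theorem mul_add_succ_mem_hooksOf {i : Fin (ℓ - 1)} {m : ℕ} :
    ℓ * m + (i + 1) ∈ hooksOf ℓ p ↔ m < p.1 i := by
  simp only [hooksOf, Finset.mem_union, Finset.mem_image, Finset.mem_biUnion, Finset.mem_univ,
    true_and, Finset.mem_range]
  constructor
  · rintro (⟨z, -, hz⟩ | ⟨j, n, hn, h⟩)
    · exact absurd ⟨z + 1, hz.symm⟩ (not_dvd_mul_add_succ i m)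
    · obtain ⟨rfl, rfl⟩ := eq_of_mul_add_succ_eq h
      exact hn
  · exact fun h => Or.inr ⟨i, m, h, rfl⟩

theorem mul_mem_hooksOf (hℓ : 0 < ℓ) {z : ℕ} : ℓ * (z + 1) ∈ hooksOf ℓ p ↔ z ∈ p.2 := by
  simp only [hooksOf, Finset.mem_union, Finset.mem_image, Finset.mem_biUnion, Finset.mem_univ,
    true_and, Finset.mem_range]
  constructor
  · rintro (⟨w, hw, h⟩ | ⟨j, n, -, h⟩)
    · have := Nat.eq_of_mul_eq_mul_left hℓ h
      rwa [← Nat.succ_injective this]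
    · exact absurd ⟨z + 1, h⟩ (not_dvd_mul_add_succ j n)
  · exact fun h => Or.inl ⟨z, h, rfl⟩

theorem zero_notMem_hooksOf (hℓ : 0 < ℓ) : 0 ∉ hooksOf ℓ p := by
  simp [hooksOf]
  omega

theorem card_hooksOf (hℓ : 0 < ℓ) : (hooksOf ℓ p).card = ∑ i, p.1 i + p.2.card := by
  rw [hooksOf, Finset.card_union_of_disjoint, Finset.card_biUnion, Finset.card_image_of_injective,
    add_comm]
  · congr 1
    refine Finset.sum_congr rfl fun i _ => ?_
    rw [Finset.card_image_of_injective _ fun m n h => (eq_of_mul_add_succ_eq h).2,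
      Finset.card_range]
  · exact fun m n h => Nat.succ_injective (Nat.eq_of_mul_eq_mul_left hℓ h)
  · intro i _ j _ hij
    rw [Function.onFun, Finset.disjoint_left]
    simp only [Finset.mem_image]
    rintro _ ⟨m, -, rfl⟩ ⟨n, -, h⟩
    exact hij (eq_of_mul_add_succ_eq h).1.symm
  · rw [Finset.disjoint_left]
    simp only [Finset.mem_image, Finset.mem_biUnion]
    rintro _ ⟨z, -, rfl⟩ ⟨i, -, m, -, h⟩
    exact not_dvd_mul_add_succ i m ⟨z + 1, h⟩

theorem hookStar_hooksOf (hℓ : 0 < ℓ) (hp : ∀ z ∈ p.2, ∀ i, z < p.1 i) :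
    HookStar ℓ (hooksOf ℓ p) := by
  intro h hh y hy
  constructor
  · intro hdvd hndvd
    obtain ⟨k, rfl⟩ := hdvd
    obtain ⟨i, m, rfl⟩ := exists_eq_mul_add_succ hℓ hndvd
    rcases k with _ | z
    · simp at hy
    · rw [mul_mem_hooksOf hℓ] at hh
      rw [mul_add_succ_mem_hooksOf]
      have : ℓ * m < ℓ * (z + 1) := by omega
      have := Nat.lt_of_mul_lt_mul_left this
      have := hp z hh i
      omega
  · intro hndvd hdvd
    have hndvd' : ¬ ℓ ∣ y := fun hc => hndvd ((Nat.dvd_sub_iff_left hy.le hc).1 hdvd)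
    obtain ⟨i, m, rfl⟩ := exists_eq_mul_add_succ hℓ hndvd'
    obtain ⟨k, hk⟩ := hdvd
    have hh' : h = ℓ * (m + k) + (i + 1) := by rw [mul_add]; omega
    rw [hh', mul_add_succ_mem_hooksOf] at hh
    rw [mul_add_succ_mem_hooksOf]
    omega

theorem exists_hooksOf_eq (hℓ : 0 < ℓ) {Y : Finset ℕ} (h0 : 0 ∉ Y) (hY : HookStar ℓ Y) :
    ∃ p : AbacusData ℓ, hooksOf ℓ p.1 = Y := by
  classical
  have hex : ∀ i : Fin (ℓ - 1), ∃ m, ℓ * m + (i + 1) ∉ Y := by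
    intro i
    by_contra! hc
    have hinj : Function.Injective fun m => ℓ * m + ((i : ℕ) + 1) :=
      fun m n h => (eq_of_mul_add_succ_eq h).2
    exact Set.infinite_of_injective_forall_mem hinj hc Y.finite_toSet
  let n : Fin (ℓ - 1) → ℕ := fun i => Nat.find (hex i)
  have hn : ∀ i m, m < n i ↔ ℓ * m + (i + 1) ∈ Y := by
    intro i m
    constructor
    · intro hm
      exact not_not.1 (Nat.find_min (hex i) hm)
    · intro hm
      by_contra! hc
      refine Nat.find_spec (hex i) ?_
      rcases hc.lt_or_eq with hlt | heq
      · have hlt' : ℓ * n i < ℓ * m := Nat.mul_lt_mul_of_pos_left hlt hℓ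
        refine (hY _ hm (ℓ * n i + (i + 1)) (by omega)).2 (not_dvd_mul_add_succ i m) ?_
        rw [Nat.add_sub_add_right, ← Nat.mul_sub]
        exact dvd_mul_right _ _
      · change ℓ * n i + (i + 1) ∈ Y
        rwa [heq]
  let Z : Finset ℕ := Y.preimage (fun z => ℓ * (z + 1))
    (fun a _ b _ h => Nat.succ_injective (Nat.eq_of_mul_eq_mul_left hℓ h))
  have hZ : ∀ z, z ∈ Z ↔ ℓ * (z + 1) ∈ Y := fun z => Finset.mem_preimage
  refine ⟨⟨(n, Z), fun z hz i => ?_⟩, Finset.ext fun x => ?_⟩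
  · have hi := i.isLt
    exact (hn i z).2 ((hY _ ((hZ z).1 hz) _ (by rw [mul_add]; omega)).1 (dvd_mul_right _ _)
      (not_dvd_mul_add_succ i z))
  · by_cases hx : ℓ ∣ x
    · obtain ⟨_ | z, rfl⟩ := hx
      · exact iff_of_false (zero_notMem_hooksOf hℓ) h0
      · rw [mul_mem_hooksOf hℓ, ← hZ]
    · obtain ⟨i, m, rfl⟩ := exists_eq_mul_add_succ hℓ hx
      rw [mul_add_succ_mem_hooksOf, ← hn]

theorem hooksOf_injective (hℓ : 0 < ℓ) : Function.Injective (hooksOf ℓ) := by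
  rintro p q h
  refine Prod.ext (funext fun i => ?_) (Finset.ext fun z => ?_)
  · have key : ∀ m, m < p.1 i ↔ m < q.1 i := fun m => by
      rw [← mul_add_succ_mem_hooksOf, h, mul_add_succ_mem_hooksOf]
    have := key (p.1 i)
    have := key (q.1 i)
    omega
  · rw [← mul_mem_hooksOf hℓ, h, mul_mem_hooksOf hℓ]

end hooksOf

theorem exists_equiv_abacusData {ℓ : ℕ} (hℓ : 2 ≤ ℓ) :
    ∃ e : AbacusData ℓ ≃ {lam : YoungDiagram // IsEllPartition ℓ lam},
      ∀ p, (e p).1.rowLen 0 = abacusWeight p := by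
  have hpos : 0 < ℓ := by omega
  let f : AbacusData ℓ → {Y : Finset ℕ // 0 ∉ Y ∧ HookStar ℓ Y} := fun p =>
    ⟨hooksOf ℓ p.1, zero_notMem_hooksOf hpos, hookStar_hooksOf hpos p.2⟩
  let g : {lam : YoungDiagram // IsEllPartition ℓ lam} → {Y : Finset ℕ // 0 ∉ Y ∧ HookStar ℓ Y} :=
    fun lam => ⟨firstHooks lam.1, zero_notMem_firstHooks lam.1,
      beadStar_iff_hookStar.1 ((isEllPartition_iff_beadStar hℓ lam.1).1 lam.2)⟩
  have hf : Function.Bijective f := by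
    refine ⟨fun p q h => Subtype.ext (hooksOf_injective hpos (congrArg Subtype.val h)), ?_⟩
    rintro ⟨Y, h0, hY⟩
    obtain ⟨p, hp⟩ := exists_hooksOf_eq hpos h0 hY
    exact ⟨p, Subtype.ext hp⟩
  have hg : Function.Bijective g := by
    refine ⟨fun p q h => Subtype.ext (firstHooks_injective (congrArg Subtype.val h)), ?_⟩
    rintro ⟨Y, h0, hY⟩
    obtain ⟨lam, rfl⟩ := exists_firstHooks_eq h0
    exact ⟨⟨lam, (isEllPartition_iff_beadStar hℓ lam).2 (beadStar_iff_hookStar.2 hY)⟩, rfl⟩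
  refine ⟨(Equiv.ofBijective f hf).trans (Equiv.ofBijective g hg).symm, fun p => ?_⟩
  have h1 := (Equiv.ofBijective g hg).apply_symm_apply (f p)
  have h2 : firstHooks ((Equiv.ofBijective g hg).symm (f p)).1 = hooksOf ℓ p.1 :=
    congrArg Subtype.val h1
  rw [abacusWeight, ← card_hooksOf hpos, ← h2, card_firstHooks]
  rfl

/-- The generating function counting the elements of `α` by weight. -/
noncomputable def weightGF {α : Type*} (w : α → ℕ) : PowerSeries ℤ :=
  PowerSeries.mk fun k => (Nat.card {a // w a = k} : ℤ)

theorem weightGF_congr {α β : Type*} {w : α → ℕ} {v : β → ℕ} (e : α ≃ β)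
    (h : ∀ a, v (e a) = w a) : weightGF w = weightGF v := by
  ext k
  rw [weightGF, weightGF, PowerSeries.coeff_mk, PowerSeries.coeff_mk,
    Nat.card_congr (e.subtypeEquiv (q := fun b => v b = k) fun a => by rw [h])]

theorem weightGF_sum {α β : Type*} {w : α → ℕ} {v : β → ℕ} (hw : ∀ k, Finite {a // w a = k})
    (hv : ∀ k, Finite {b // v b = k}) :
    weightGF (Sum.elim w v) = weightGF w + weightGF v := by
  ext k
  have := hw k
  have := hv k
  rw [map_add, weightGF, weightGF, weightGF, PowerSeries.coeff_mk, PowerSeries.coeff_mk,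
    PowerSeries.coeff_mk, Nat.card_congr Equiv.subtypeSum, ← Nat.cast_add, ← Nat.card_sum]
  rfl

theorem weightGF_add_const {α : Type*} (w : α → ℕ) (p : ℕ) :
    weightGF (fun a => w a + p) = PowerSeries.X ^ p * weightGF w := by
  ext k
  rw [PowerSeries.coeff_X_pow_mul', weightGF, weightGF, PowerSeries.coeff_mk,
    PowerSeries.coeff_mk]
  split_ifs with h
  · rw [Nat.card_congr (Equiv.subtypeEquivRight (q := fun a => w a = k - p) fun a => by omega)]
  · have : IsEmpty {a // w a + p = k} := ⟨fun a => by have := a.2; omega⟩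
    simp

theorem finite_sum_eq (ι : Type*) [Fintype ι] (k : ℕ) : Finite {n : ι → ℕ // ∑ i, n i = k} := by
  classical
  refine Set.Finite.subset (Set.finite_Iic fun _ : ι => k) fun n hn i => ?_
  rw [← show ∑ i, n i = k from hn]
  exact Finset.single_le_sum (fun _ _ => Nat.zero_le _) (Finset.mem_univ i)

theorem one_sub_X_pow_mul_weightGF (ι : Type*) [Fintype ι] :
    (1 - PowerSeries.X : PowerSeries ℤ) ^ Fintype.card ι *
      weightGF (fun n : ι → ℕ => ∑ i, n i) = 1 := by
  classical
  have h : weightGF (fun n : ι → ℕ => ∑ i, n i) = PowerSeries.mk 1 ^ Fintype.card ι := by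
    ext k
    rw [← Finset.card_univ, ← Finset.prod_const, PowerSeries.coeff_prod, weightGF,
      PowerSeries.coeff_mk]
    simp only [PowerSeries.coeff_mk, Pi.one_apply, Finset.prod_const_one, Finset.sum_const,
      nsmul_eq_mul, mul_one]
    rw [Nat.card_congr (Finsupp.equivFunOnFinite.symm.subtypeEquiv
      (q := fun f : ι →₀ ℕ => f ∈ Finset.univ.finsuppAntidiag k) fun n => by
        simp [Finset.mem_finsuppAntidiag]), Nat.subtype_card _ fun _ => Iff.rfl]
  rw [h, ← mul_pow, mul_comm, PowerSeries.mk_one_mul_one_sub_eq_one, one_pow]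

/-- The functions with a zero value. -/
abbrev VanishingFun (ι : Type*) : Type _ := {n : ι → ℕ // ∃ i, n i = 0}

theorem finite_vanishingFun (ι : Type*) [Fintype ι] (k : ℕ) :
    Finite {n : VanishingFun ι // ∑ i, n.1 i = k} := by
  have := finite_sum_eq ι k
  exact Finite.of_injective
    (fun n => (⟨n.1.1, n.2⟩ : {n : ι → ℕ // ∑ i, n i = k}))
    fun a b h => Subtype.ext (Subtype.ext (congrArg (fun x => x.1) h))

theorem finite_abacusData {ℓ : ℕ} (hℓ : 2 ≤ ℓ) (k : ℕ) :
    Finite {p : AbacusData ℓ // abacusWeight p = k} := by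
  have hfin := ((Set.finite_Iic fun _ : Fin (ℓ - 1) => k).prod
    (Finset.range k).powerset.finite_toSet).to_subtype
  refine Finite.of_injective (fun p => (⟨p.1.1, ?_, ?_⟩ :
    ((Set.Iic fun _ : Fin (ℓ - 1) => k) ×ˢ ((Finset.range k).powerset : Set (Finset ℕ)) :
      Set ((Fin (ℓ - 1) → ℕ) × Finset ℕ))))
    fun a b h => Subtype.ext (Subtype.ext (congrArg (fun x => x.1) h))
  all_goals
    obtain ⟨⟨⟨n, Z⟩, hZ⟩, hk⟩ := p
    have hle : ∀ i, n i ≤ k := fun i => by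
      have := Finset.single_le_sum (f := n) (fun _ _ => Nat.zero_le _) (Finset.mem_univ i)
      simp only [abacusWeight] at hk
      omega
  · exact hle
  · rw [Finset.mem_coe, Finset.mem_powerset]
    intro z hz
    rw [Finset.mem_range]
    exact (hZ z hz ⟨0, by omega⟩).trans_le (hle _)

/-- Raise all counts by one and all positions in `Z` by one. -/
def AbacusData.raise {ℓ : ℕ} (p : AbacusData ℓ) : AbacusData ℓ :=
  ⟨(fun i => p.1.1 i + 1, p.1.2.map ⟨Nat.succ, Nat.succ_injective⟩), by
    intro z hz i
    obtain ⟨w, hw, rfl⟩ := Finset.mem_map.1 hz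
    exact Nat.succ_lt_succ (p.2 w hw i)⟩

/-- Raise, and fill the freed position `0` in `Z`. -/
def AbacusData.raiseInsert {ℓ : ℕ} (p : AbacusData ℓ) : AbacusData ℓ :=
  ⟨(p.raise.1.1, insert 0 p.raise.1.2), by
    intro z hz i
    rcases Finset.mem_insert.1 hz with rfl | hz
    · exact Nat.succ_pos _
    · exact p.raise.2 z hz i⟩

/-- The data with empty `Z`. -/
def AbacusData.ofFun {ℓ : ℕ} (n : Fin (ℓ - 1) → ℕ) : AbacusData ℓ := ⟨(n, ∅), by simp⟩

namespace AbacusData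

variable {ℓ : ℕ}

theorem zero_notMem_raise (p : AbacusData ℓ) : 0 ∉ p.raise.1.2 := by
  simp [raise]

theorem raise_injective : Function.Injective (raise (ℓ := ℓ)) := by
  intro p q h
  refine Subtype.ext (Prod.ext (funext fun i => ?_) ?_)
  · exact Nat.succ_injective (congrArg (fun x => x.1.1 i) h)
  · exact Finset.map_injective _ (congrArg (fun x => x.1.2) h)

theorem raiseInsert_injective : Function.Injective (raiseInsert (ℓ := ℓ)) := by
  intro p q h
  refine raise_injective (Subtype.ext (Prod.ext (congrArg (fun x => x.1.1) h) ?_))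
  have h2 : insert 0 p.raise.1.2 = insert 0 q.raise.1.2 := congrArg (fun x => x.1.2) h
  rw [← Finset.erase_insert p.zero_notMem_raise, h2, Finset.erase_insert q.zero_notMem_raise]

theorem exists_raise_eq {p : AbacusData ℓ} (hn : ∀ i, p.1.1 i ≠ 0) :
    (∃ q : AbacusData ℓ, q.raise = p) ∨ ∃ q : AbacusData ℓ, q.raiseInsert = p := by
  obtain ⟨⟨n, Z⟩, hZ⟩ := p
  let W : Finset ℕ := Z.preimage Nat.succ Nat.succ_injective.injOn
  have hW : ∀ z, z ∈ W ↔ z + 1 ∈ Z := fun z => Finset.mem_preimage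
  let q : AbacusData ℓ := ⟨(fun i => n i - 1, W), fun z hz i => by
    have h1 := hZ _ ((hW z).1 hz) i
    simp only at h1 ⊢
    omega⟩
  have hq : (fun i => n i - 1 + 1) = n := funext fun i => Nat.succ_pred (hn i)
  by_cases h0 : 0 ∈ Z
  · refine Or.inr ⟨q, Subtype.ext (Prod.ext hq (Finset.ext fun z => ?_))⟩
    rcases z with _ | z <;> simp [raiseInsert, raise, q, hW, h0]
  · refine Or.inl ⟨q, Subtype.ext (Prod.ext hq (Finset.ext fun z => ?_))⟩
    rcases z with _ | z <;> simp [raise, q, hW, h0]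

theorem abacusWeight_raise (p : AbacusData ℓ) :
    abacusWeight p.raise = abacusWeight p + (ℓ - 1) := by
  simp [abacusWeight, raise, Finset.sum_add_distrib]
  omega

theorem abacusWeight_raiseInsert (hℓ : 0 < ℓ) (p : AbacusData ℓ) :
    abacusWeight p.raiseInsert = abacusWeight p + ℓ := by
  have h1 := p.abacusWeight_raise
  have h2 : abacusWeight p.raiseInsert = abacusWeight p.raise + 1 := by
    simp only [abacusWeight, raiseInsert]
    rw [Finset.card_insert_of_notMem p.zero_notMem_raise, add_assoc]
  omega

/-- Peel off one layer of an abacus: either some count vanishes, and then `Z` is empty, or all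
counts and positions can be lowered. -/
theorem bijective_elim : Function.Bijective
    (Sum.elim (fun n : VanishingFun (Fin (ℓ - 1)) => ofFun n.1)
      (Sum.elim (raise (ℓ := ℓ)) raiseInsert)) := by
  constructor
  · refine Function.Injective.sumElim ?_ (raise_injective.sumElim raiseInsert_injective ?_) ?_
    · exact fun a b h => Subtype.ext (congrArg (fun x => x.1.1) h)
    · intro a b h
      refine a.zero_notMem_raise ?_
      rw [h]
      exact Finset.mem_insert_self _ _
    · rintro ⟨n, i, hi⟩ (b | b) h
      · have := congrArg (fun x => x.1.1 i) h
        simp [ofFun, raise, hi] at this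
      · have := congrArg (fun x => x.1.1 i) h
        simp [ofFun, raiseInsert, raise, hi] at this
  · intro p
    by_cases h : ∃ i, p.1.1 i = 0
    · refine ⟨Sum.inl ⟨p.1.1, h⟩, Subtype.ext (Prod.ext rfl ?_)⟩
      obtain ⟨i, hi⟩ := h
      refine (Finset.eq_empty_of_forall_notMem fun z hz => ?_).symm
      have := p.2 z hz i
      omega
    · push Not at h
      rcases exists_raise_eq h with ⟨q, hq⟩ | ⟨q, hq⟩
      · exact ⟨Sum.inr (Sum.inl q), hq⟩
      · exact ⟨Sum.inr (Sum.inr q), hq⟩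

end AbacusData

theorem finite_add_const {α : Type*} {w : α → ℕ} (hw : ∀ k, Finite {a // w a = k}) (p k : ℕ) :
    Finite {a // w a + p = k} := by
  have := hw (k - p)
  exact Finite.of_injective
    (fun a => (⟨a.1, by have := a.2; omega⟩ : {a // w a = k - p}))
    fun a b h => Subtype.ext (congrArg (fun x => x.1) h)

theorem finite_sumElim {α β : Type*} {w : α → ℕ} {v : β → ℕ} (hw : ∀ k, Finite {a // w a = k})
    (hv : ∀ k, Finite {b // v b = k}) (k : ℕ) : Finite {c // Sum.elim w v c = k} := by
  have : Finite {a // Sum.elim w v (Sum.inl a) = k} := hw k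
  have : Finite {b // Sum.elim w v (Sum.inr b) = k} := hv k
  exact Finite.of_equiv _ Equiv.subtypeSum.symm

theorem weightGF_abacusData {ℓ : ℕ} (hℓ : 2 ≤ ℓ) :
    weightGF (abacusWeight (ℓ := ℓ)) =
      weightGF (fun n : VanishingFun (Fin (ℓ - 1)) => ∑ i, n.1 i) +
        (PowerSeries.X ^ (ℓ - 1) * weightGF (abacusWeight (ℓ := ℓ)) +
          PowerSeries.X ^ ℓ * weightGF (abacusWeight (ℓ := ℓ))) := by
  have hfin := finite_abacusData hℓ
  rw [← weightGF_add_const, ← weightGF_add_const,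
    ← weightGF_sum (finite_add_const hfin _) (finite_add_const hfin _),
    ← weightGF_sum (finite_vanishingFun _)
      (finite_sumElim (finite_add_const hfin _) (finite_add_const hfin _))]
  refine (weightGF_congr (Equiv.ofBijective _ AbacusData.bijective_elim) ?_).symm
  rintro (n | p | p)
  · simp [abacusWeight, AbacusData.ofFun]
  · exact p.abacusWeight_raise
  · exact p.abacusWeight_raiseInsert (by omega)

theorem weightGF_fun (ι : Type*) [Fintype ι] [Nonempty ι] :
    weightGF (fun n : ι → ℕ => ∑ i, n i) =
      weightGF (fun n : VanishingFun ι => ∑ i, n.1 i) +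
        PowerSeries.X ^ Fintype.card ι * weightGF (fun n : ι → ℕ => ∑ i, n i) := by
  rw [← weightGF_add_const,
    ← weightGF_sum (finite_vanishingFun _) (finite_add_const (finite_sum_eq ι) _)]
  have hbij : Function.Bijective
      (Sum.elim (fun n : VanishingFun ι => n.1) fun (n : ι → ℕ) i => n i + 1) := by
    constructor
    · refine Subtype.val_injective.sumElim
        (fun a b h => funext fun i => Nat.succ_injective (congrFun h i)) ?_
      rintro ⟨n, i, hi⟩ b h
      have := congrFun h i
      simp [hi] at this
    · intro n
      by_cases h : ∃ i, n i = 0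
      · exact ⟨Sum.inl ⟨n, h⟩, rfl⟩
      · push Not at h
        exact ⟨Sum.inr fun i => n i - 1, funext fun i => Nat.succ_pred (h i)⟩
  refine (weightGF_congr (Equiv.ofBijective _ hbij) ?_).symm
  rintro (n | n)
  · rfl
  · simp [Finset.sum_add_distrib]

/-- The generating function `B_ℓ(x)` for `ℓ`-partitions by largest part satisfies
`B_ℓ(x) = (1 - x^{ℓ-1}) / ((1-x)^{ℓ-1} (1 - x^{ℓ-1} - x^ℓ))` as a formal power
series identity over `ℤ`. -/
theorem stmt_9 (ℓ : ℕ) (hℓ : 2 ≤ ℓ) :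
    (1 - PowerSeries.X : PowerSeries ℤ) ^ (ℓ - 1) *
      ((1 : PowerSeries ℤ) - PowerSeries.X ^ (ℓ - 1) - PowerSeries.X ^ ℓ) *
      PowerSeries.mk (fun k =>
        (Nat.card {lam : YoungDiagram // IsEllPartition ℓ lam ∧ lam.rowLen 0 = k} : ℤ)) =
      (1 : PowerSeries ℤ) - PowerSeries.X ^ (ℓ - 1) := by
  have hcount : (PowerSeries.mk fun k =>
      (Nat.card {lam : YoungDiagram // IsEllPartition ℓ lam ∧ lam.rowLen 0 = k} : ℤ)) =
      weightGF (abacusWeight (ℓ := ℓ)) := by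
    obtain ⟨e, he⟩ := exists_equiv_abacusData hℓ
    rw [weightGF_congr (v := fun lam => lam.1.rowLen 0) e he]
    ext k
    rw [weightGF, PowerSeries.coeff_mk, PowerSeries.coeff_mk,
      Nat.card_congr (Equiv.subtypeSubtypeEquivSubtypeInter (IsEllPartition ℓ)
        fun lam => lam.rowLen 0 = k)]
  have : Nonempty (Fin (ℓ - 1)) := ⟨⟨0, by omega⟩⟩
  have hB := weightGF_abacusData hℓ
  have hC := weightGF_fun (Fin (ℓ - 1))
  have hone := one_sub_X_pow_mul_weightGF (Fin (ℓ - 1))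
  rw [Fintype.card_fin] at hC hone
  rw [hcount]
  linear_combination (1 - PowerSeries.X) ^ (ℓ - 1) * (hB - hC) +
    (1 - PowerSeries.X ^ (ℓ - 1)) * hone
end

section
/- A partition is an (ℓ,0)-JM partition if and only if it is a generalized ℓ-partition. -/
/-- `lam` is an `(ℓ,0)`-JM partition: there do not exist boxes `(a,b)`, `(a,y)`,
`(x,b)` of `lam` with `ℓ ∣ h_{(a,b)}` while `ℓ ∤ h_{(a,y)}` and `ℓ ∤ h_{(x,b)}`. -/
def IsJM (ℓ : ℕ) (lam : YoungDiagram) : Prop :=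
  ¬ ∃ a b x y : ℕ, (a, b) ∈ lam ∧ (a, y) ∈ lam ∧ (x, b) ∈ lam ∧
    ℓ ∣ hookLen lam a b ∧ ¬ ℓ ∣ hookLen lam a y ∧ ¬ ℓ ∣ hookLen lam x b

/-- Two sets of cells are adjacent if some cell of one shares an edge with some
cell of the other. -/
def AdjacentSets (s t : Finset (ℕ × ℕ)) : Prop := ∃ p ∈ s, ∃ q ∈ t, AdjCell p q

/-- `b` is obtained from `a` by removing one horizontal or vertical removable
`ℓ`-rim hook. -/
def RemoveHV (ℓ : ℕ) (a b : YoungDiagram) : Prop :=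
  ∃ s, IsRemovableRimHook ℓ a s ∧ (HorizontalCells s ∨ VerticalCells s) ∧
    b.cells = a.cells \ s

/-- Conditions (1) and (2) of a generalized `ℓ`-partition for a single diagram `μ`:
every removable `ℓ`-rim hook is horizontal or vertical, and no vertical (resp.
horizontal) removable `ℓ`-rim hook `R` of `μ` is adjacent to a horizontal (resp.
vertical) removable `ℓ`-rim hook `S` of `μ ∖ R`. -/
def Cond12 (ℓ : ℕ) (μ : YoungDiagram) : Prop :=
  (∀ s, IsRemovableRimHook ℓ μ s → HorizontalCells s ∨ VerticalCells s) ∧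
  (∀ (R : Finset (ℕ × ℕ)) (ν : YoungDiagram) (S : Finset (ℕ × ℕ)),
    IsRemovableRimHook ℓ μ R → ν.cells = μ.cells \ R → IsRemovableRimHook ℓ ν S →
    ((VerticalCells R ∧ HorizontalCells S) ∨ (HorizontalCells R ∧ VerticalCells S)) →
    ¬ AdjacentSets R S)

/-- `lam` is a generalized `ℓ`-partition: conditions (1) and (2) hold for `lam` and
for every diagram obtained from `lam` by removing any sequence of horizontal and
vertical `ℓ`-rim hooks. -/
def IsGeneralized (ℓ : ℕ) (lam : YoungDiagram) : Prop :=
  ∀ μ : YoungDiagram, Relation.ReflTransGen (RemoveHV ℓ) lam μ → Cond12 ℓ μ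

/-- The configuration obtained from the bead configuration `B` by moving the bead at
`i + L` to the position `i`. -/
def slide (L : ℤ) (B : ℤ → Prop) (i : ℤ) : ℤ → Prop := fun n => n = i ∨ (B n ∧ n ≠ i + L)

/-- The bead at `i + L` can be moved to `i` across gaps only. -/
def SlidesOverGaps (L : ℤ) (B : ℤ → Prop) (i : ℤ) : Prop :=
  B (i + L) ∧ ∀ n, i ≤ n → n < i + L → ¬ B n

/-- The bead at `i + L` can be moved to `i` across beads only. -/
def SlidesOverBeads (L : ℤ) (B : ℤ → Prop) (i : ℤ) : Prop :=
  ¬ B i ∧ ∀ n, i < n → n ≤ i + L → B n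

/-- The `(ℓ,0)`-JM condition for a bead configuration. -/
def BeadJM (L : ℤ) (B : ℤ → Prop) : Prop :=
  ∀ p i q r, B p → ¬ B i → i < p → p % L = i % L → q < p → ¬ B q → q % L ≠ p % L →
    i < r → B r → r % L ≠ i % L → False

/-- The bead configuration of the conjugate partition. -/
def conjBeads (B : ℤ → Prop) : ℤ → Prop := fun n => ¬ B (-n)

theorem Int.eq_of_emod_eq_of_lt {L x y : ℤ} (h : x % L = y % L) (h₁ : x < y + L)
    (h₂ : y < x + L) : x = y := by
  have hd : L ∣ x - y := Int.ModEq.dvd (show y ≡ x [ZMOD L] from h.symm)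
  have := Int.eq_zero_of_abs_lt_dvd hd (by rw [abs_lt]; constructor <;> omega)
  omega

theorem Int.neg_emod_eq_neg_emod_iff {L x y : ℤ} : (-x) % L = (-y) % L ↔ x % L = y % L :=
  ⟨fun h => by simpa only [neg_neg] using Int.ModEq.eq (Int.ModEq.neg (n := L) h),
    fun h => Int.ModEq.neg (n := L) h⟩

section Beads

variable {L : ℤ} {B : ℤ → Prop}

theorem conjBeads_conjBeads : conjBeads (conjBeads B) = B := by
  funext n; simp [conjBeads]

theorem BeadJM.conj (h : BeadJM L B) : BeadJM L (conjBeads B) := by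
  intro p i q r hp hi hip hc hq hBq hcq hr hBr hcr
  simp only [conjBeads, not_not] at *
  refine h (-i) (-p) (-r) (-q) hi hp (by omega) ?_ (by omega) hBr ?_ (by omega) hBq ?_
  · exact Int.neg_emod_eq_neg_emod_iff.2 hc.symm
  · exact fun h => hcr (Int.neg_emod_eq_neg_emod_iff.1 h)
  · exact fun h => hcq (Int.neg_emod_eq_neg_emod_iff.1 h)

theorem slide_conjBeads (hL : 0 < L) (i : ℤ) :
    slide L (conjBeads B) i = conjBeads (slide L B (-(i + L))) := by
  funext n
  simp only [slide, conjBeads, not_or, not_and, not_not, eq_iff_iff]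
  constructor
  · rintro (h | h)
    · subst h; exact ⟨by omega, fun _ => by omega⟩
    · exact ⟨by omega, fun h' => absurd h' h.1⟩
  · rintro ⟨h, h'⟩
    by_cases hn : n = i
    · exact Or.inl hn
    · refine Or.inr ⟨fun hB => ?_, by omega⟩
      have := h' hB
      omega

theorem slidesOverGaps_conjBeads {i : ℤ} :
    SlidesOverGaps L (conjBeads B) i ↔ SlidesOverBeads L B (-(i + L)) := by
  simp only [SlidesOverGaps, SlidesOverBeads, conjBeads, not_not]
  refine and_congr Iff.rfl ⟨fun h n h₁ h₂ => ?_, fun h n h₁ h₂ => h _ (by omega) (by omega)⟩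
  simpa using h (-n) (by omega) (by omega)

theorem slidesOverBeads_conjBeads {i : ℤ} :
    SlidesOverBeads L (conjBeads B) i ↔ SlidesOverGaps L B (-(i + L)) := by
  conv_rhs => rw [← conjBeads_conjBeads (B := B), slidesOverGaps_conjBeads]
  simp

/-- Sliding a bead over gaps preserves the JM condition. -/
theorem BeadJM.slide_gaps (hL : 2 < L) (h : BeadJM L B) {i : ℤ} (hi : SlidesOverGaps L B i) :
    BeadJM L (slide L B i) := by
  obtain ⟨hb, hg⟩ := hi
  have hLL : (i + L) % L = i % L := by simp
  have key : ∀ r, i < r → B r → r % L = i % L := by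
    intro r hr hBr
    by_contra hcr
    refine h (i + L) i (i + 1) r hb (hg i (by omega) (by omega)) (by omega) hLL (by omega)
      (hg _ (by omega) (by omega)) ?_ hr hBr hcr
    intro h1
    have := Int.eq_of_emod_eq_of_lt (h1.trans hLL) (by omega) (by omega)
    omega
  intro p i' q r hp hi' hip hc hq hBq hcq hr hBr hcr
  simp only [slide, not_or, not_and, not_not] at *
  have : ∀ x, B x → i < x → x % L = i % L := fun x hx hxi => key x hxi hx
  unfold BeadJM at h
  by_cases hii : i ≤ i'
  · grind
  have hB1 : ¬ B i' := by grind
  have hr' : ∃ r', i' < r' ∧ B r' ∧ r' % L ≠ i' % L := by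
    rcases hBr with rfl | h1
    · exact ⟨r + L, by omega, hb, by grind⟩
    · exact ⟨r, hr, h1.1, hcr⟩
  obtain ⟨r', h1, h2, h3⟩ := hr'
  by_cases hpi : p = i
  · refine h (i + L) i' q r' hb hB1 (by omega) (by grind) (by omega) (by grind) (by grind) h1 h2 h3
  · refine h p i' q r' (by grind) hB1 (by omega) (by grind) (by omega) ?_ (by grind) h1 h2 h3
    intro hq'
    have := hBq.2 hq'
    have := key p (by omega) (by grind)
    grind

theorem BeadJM.slide_beads (hL : 2 < L) (h : BeadJM L B) {i : ℤ} (hi : SlidesOverBeads L B i) :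
    BeadJM L (slide L B i) := by
  have h1 : SlidesOverGaps L (conjBeads B) (-(i + L)) := by
    rw [slidesOverGaps_conjBeads]; simpa using hi
  have h2 := (h.conj.slide_gaps hL h1).conj
  rw [slide_conjBeads (by omega), conjBeads_conjBeads] at h2
  simpa using h2

theorem BeadJM.slidesOver (h : BeadJM L B) {i : ℤ} (hb : B (i + L)) (hi : ¬ B i) :
    SlidesOverGaps L B i ∨ SlidesOverBeads L B i := by
  have hLL : (i + L) % L = i % L := by simp
  have hne : ∀ x, i < x → x < i + L → x % L ≠ i % L := fun x h1 h2 h3 => by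
    have := Int.eq_of_emod_eq_of_lt h3 (by omega) (by omega)
    omega
  by_contra! hcon
  have h1 : ∃ r, i < r ∧ r < i + L ∧ B r := by
    by_contra! h1
    refine hcon.1 ⟨hb, fun n hn hn' => ?_⟩
    rcases hn.eq_or_lt with rfl | hn
    · exact hi
    · exact h1 n hn hn'
  have h2 : ∃ q, i < q ∧ q < i + L ∧ ¬ B q := by
    by_contra! h1
    refine hcon.2 ⟨hi, fun n hn hn' => ?_⟩
    rcases hn'.eq_or_lt with rfl | hn'
    · exact hb
    · exact h1 n hn hn'
  obtain ⟨r, hr1, hr2, hr⟩ := h1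
  obtain ⟨q, hq1, hq2, hq⟩ := h2
  exact h (i + L) i q r hb hi (by omega) hLL hq2 hq (by rw [hLL]; exact hne q hq1 hq2) hr1 hr
    (hne r hr1 hr2)

/-- In a JM configuration, a slide over gaps is not next to a slide over beads. -/
theorem BeadJM.not_beads_gaps (hL : 2 < L) (h : BeadJM L B) {i i' n n' : ℤ}
    (hv : SlidesOverBeads L B i) (hg : SlidesOverGaps L (slide L B i) i')
    (h₁ : i ≤ n) (h₂ : n < i + L) (h₃ : i' ≤ n') (h₄ : n' < i' + L) (h₅ : n ≤ n' + 1)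
    (h₆ : n' ≤ n + 1) : False := by
  have hne : ∀ x y : ℤ, y < x → x < y + L → x % L ≠ y % L := fun x y h1 h2 h3 => by
    have := Int.eq_of_emod_eq_of_lt h3 (by omega) (by omega)
    omega
  have hout : i' ≤ i → i < i' + L → False := fun h1 h2 => hg.2 i h1 h2 (Or.inl rfl)
  have hin : i < i' → i' < i + L → False := fun h1 h2 =>
    hg.2 i' le_rfl (by omega) (Or.inr ⟨hv.2 _ h1 (by omega), by omega⟩)
  by_cases hlt : i + L ≤ i'
  · obtain rfl : i' = i + L := by omega
    refine h (i + L + L) i (i + L + 1) (i + 1) ?_ hv.1 (by omega) (by simp) (by omega) ?_ ?_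
      (by omega) (hv.2 _ (by omega) (by omega)) (hne _ _ (by omega) (by omega))
    · rcases hg.1 with h1 | h1
      · omega
      · exact h1.1
    · exact fun hB => hg.2 (i + L + 1) (by omega) (by omega) (Or.inr ⟨hB, by omega⟩)
    · rw [Int.add_emod_right (i + L)]
      exact hne _ _ (by omega) (by omega)
  · have h₇ : i' ≤ i := not_lt.1 fun h1 => hin h1 (by omega)
    have h₈ : i' + L ≤ i := not_lt.1 fun h1 => hout h₇ h1
    obtain rfl : i = i' + L := by omega
    refine h (i' + L + L) i' (i' + L - 1) (i' + L + 1) (hv.2 _ (by omega) le_rfl) ?_ (by omega)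
      (by simp) (by omega) ?_ ?_ (by omega) (hv.2 _ (by omega) (by omega)) ?_
    · exact fun hB => hg.2 i' le_rfl (by omega) (Or.inr ⟨hB, by omega⟩)
    · exact fun hB => hg.2 (i' + L - 1) (by omega) (by omega) (Or.inr ⟨hB, by omega⟩)
    · rw [Int.add_emod_right]
      exact (hne _ _ (by omega) (by omega)).symm
    · rw [← Int.add_emod_right i']
      exact hne _ _ (by omega) (by omega)

theorem BeadJM.not_gaps_beads (hL : 2 < L) (h : BeadJM L B) {i i' n n' : ℤ}
    (hg : SlidesOverGaps L B i) (hv : SlidesOverBeads L (slide L B i) i')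
    (h₁ : i ≤ n) (h₂ : n < i + L) (h₃ : i' ≤ n') (h₄ : n' < i' + L) (h₅ : n ≤ n' + 1)
    (h₆ : n' ≤ n + 1) : False := by
  refine h.conj.not_beads_gaps hL (i := -(i + L)) (i' := -(i' + L)) (n := -n - 1) (n' := -n' - 1)
    ?_ ?_ (by omega) (by omega) (by omega) (by omega) (by omega) (by omega)
  · rw [slidesOverBeads_conjBeads]
    simpa using hg
  · rw [slide_conjBeads (by omega), slidesOverGaps_conjBeads]
    simpa using hv

/-- A bead configuration all of whose slides are over gaps or over beads, which has no slide
over gaps next to a slide over beads, and all of whose slides lead to JM configurations. -/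
structure SlidesToJM (L : ℤ) (B : ℤ → Prop) : Prop where
  slidesOver : ∀ i, B (i + L) → ¬ B i → SlidesOverGaps L B i ∨ SlidesOverBeads L B i
  not_gaps_beads : ∀ i, ¬ (SlidesOverGaps L B i ∧ SlidesOverBeads L (slide L B i) (i - L))
  not_beads_gaps : ∀ i, ¬ (SlidesOverBeads L B i ∧ SlidesOverGaps L (slide L B i) (i + L))
  slide_gaps : ∀ i, SlidesOverGaps L B i → BeadJM L (slide L B i)
  slide_beads : ∀ i, SlidesOverBeads L B i → BeadJM L (slide L B i)

theorem SlidesToJM.conj (hL : 0 < L) (h : SlidesToJM L B) : SlidesToJM L (conjBeads B) := by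
  constructor
  · intro i h1 h2
    rw [slidesOverGaps_conjBeads, slidesOverBeads_conjBeads, or_comm]
    exact h.slidesOver _ (by simpa [conjBeads] using h2) (by simpa [conjBeads] using h1)
  · intro i
    rw [slidesOverGaps_conjBeads, slide_conjBeads hL, slidesOverBeads_conjBeads]
    have := h.not_beads_gaps (-(i + L))
    convert this using 4
    ring
  · intro i
    rw [slidesOverBeads_conjBeads, slide_conjBeads hL, slidesOverGaps_conjBeads]
    have := h.not_gaps_beads (-(i + L))
    convert this using 4
    ring
  · intro i hi
    rw [slide_conjBeads hL]
    exact (h.slide_beads _ (slidesOverGaps_conjBeads.1 hi)).conj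
  · intro i hi
    rw [slide_conjBeads hL]
    exact (h.slide_gaps _ (slidesOverBeads_conjBeads.1 hi)).conj

theorem SlidesToJM.false_of_slidesOverGaps (hL : 2 < L) (h : SlidesToJM L B) {i q r : ℤ}
    (hi : SlidesOverGaps L B i) (hq : q < i + L) (hBq : ¬ B q) (hcq : q % L ≠ i % L)
    (hr : i < r) (hBr : B r) (hcr : r % L ≠ i % L) : False := by
  have hLL : ∀ x : ℤ, (x + L) % L = x % L := by simp
  have hLm : ∀ x : ℤ, (x - L) % L = x % L := by simp
  obtain ⟨r, ⟨hr, hBr, hcr⟩, hmin⟩ := Int.exists_least_of_bdd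
    (P := fun r => i < r ∧ B r ∧ r % L ≠ i % L) ⟨i, fun z hz => hz.1.le⟩ ⟨r, hr, hBr, hcr⟩
  have hi' := hi
  obtain ⟨hb, hg⟩ := hi
  have hrL : i + L < r := by grind
  have hgap : ¬ B (r - L) := by
    intro hB
    have := hmin (r - L) ⟨by omega, hB, by rw [hLm]; exact hcr⟩
    omega
  have hgap' : ∀ x, i < x → x < r → x % L ≠ i % L → ¬ B x := fun x h1 h2 h3 hB => by
    have := hmin x ⟨h1, hB, h3⟩
    omega
  have hnear : ∀ x y, x % L = y % L → x < y + L → y < x + L → x = y :=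
    fun x y => Int.eq_of_emod_eq_of_lt
  have hsl := h.slidesOver (r - L) (by simpa using hBr) hgap
  have hnv : ¬ SlidesOverBeads L B (r - L) := by
    intro hv
    have h1 := hv.2 (r - 1) (by omega) (by omega)
    have h2 := hv.2 (r - 2) (by omega) (by omega)
    have h3 : (r - 1) % L = i % L := by
      by_contra h3
      exact hgap' _ (by omega) (by omega) h3 h1
    have h4 : (r - 2) % L = i % L := by
      by_contra h4
      exact hgap' _ (by omega) (by omega) h4 h2
    have := hnear _ _ (h3.trans h4.symm) (by omega) (by omega)
    omega
  have hh := hsl.resolve_right hnv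
  have hiL : i + L < r - L := by
    by_contra hcon
    rcases (not_lt.1 hcon).eq_or_lt with he | hlt
    · apply hcr
      rw [← hLm, he, hLL]
    · exact hh.2 (i + L) (by omega) (by omega) hb
  refine h.slide_gaps _ hh (i + L) i q (r - L) ?_ ?_ (by omega) (hLL i) hq ?_ ?_ (by omega) ?_ ?_
  · exact Or.inr ⟨hb, by omega⟩
  · rintro (h1 | h1)
    · omega
    · exact hg i le_rfl (by omega) h1.1
  · rintro (h1 | h1)
    · omega
    · exact hBq h1.1
  · rwa [hLL]
  · exact Or.inl rfl
  · rwa [hLm]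

theorem SlidesToJM.false_of_slidesOverBeads (hL : 2 < L) (h : SlidesToJM L B) {i q r : ℤ}
    (hi : SlidesOverBeads L B i) (hq : q < i + L) (hBq : ¬ B q) (hcq : q % L ≠ i % L)
    (hr : i < r) (hBr : B r) (hcr : r % L ≠ i % L) : False := by
  have hneg : ∀ x : ℤ, (-x) % L = (-(i + L)) % L ↔ x % L = i % L := fun x => by
    rw [Int.neg_emod_eq_neg_emod_iff, Int.add_emod_right]
  refine (h.conj (by omega)).false_of_slidesOverGaps hL (i := -(i + L)) (q := -r) (r := -q)
    (by rw [slidesOverGaps_conjBeads]; simpa using hi) (by omega) (by simpa [conjBeads])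
    (by rwa [Ne, hneg]) (by omega) (by simpa [conjBeads]) (by rwa [Ne, hneg])

/-- If all slides of a configuration behave well, then the configuration itself is JM. -/
theorem SlidesToJM.beadJM (hL : 2 < L) (h : SlidesToJM L B) : BeadJM L B := by
  suffices H : ∀ d : ℕ, ∀ p i q r, (p - i).toNat = d → B p → ¬ B i → i < p → p % L = i % L →
      q < p → ¬ B q → q % L ≠ p % L → i < r → B r → r % L ≠ i % L → False from
    fun p i q r => H _ p i q r rfl
  intro d
  induction d using Nat.strong_induction_on with
  | _ d ih =>
  intro p i q r hd hp hi hip hc hq hBq hcq hr hBr hcr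
  have ih' : ∀ p' i' q r, p' - i' < p - i → B p' → ¬ B i' → i' < p' → p' % L = i' % L →
      q < p' → ¬ B q → q % L ≠ p' % L → i' < r → B r → r % L ≠ i' % L → False :=
    fun p' i' q r hlt h1 h2 h3 => ih _ (by omega) p' i' q r rfl h1 h2 h3
  clear ih hd d
  have hLL : ∀ x : ℤ, (x + L) % L = x % L := by simp
  have hLm : ∀ x : ℤ, (x - L) % L = x % L := by simp
  have hnear : ∀ x y, x % L = y % L → x < y + L → y < x + L → x = y :=
    fun x y => Int.eq_of_emod_eq_of_lt
  have hlow : ∀ m, i < m → m < p → m % L = i % L → B m → ∀ x, x < m → ¬ B x → x % L = i % L := by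
    intro m h1 h2 h3 h4 x h5 h6
    by_contra h7
    exact ih' m i x r (by omega) h4 hi h1 h3 h5 h6 (by rwa [h3]) hr hBr hcr
  have hhigh : ∀ m, i < m → m < p → m % L = i % L → ¬ B m → ∀ x, m < x → B x → x % L = i % L := by
    intro m h1 h2 h3 h4 x h5 h6
    by_contra h7
    exact ih' p m q x (by omega) hp h4 h2 (by rw [hc, h3]) hq hBq hcq h5 h6 (by rwa [h3])
  clear ih'
  by_cases h1 : p = i + L
  · subst h1
    rw [hc] at hcq
    rcases h.slidesOver i hp hi with h1 | h1
    · exact h.false_of_slidesOverGaps hL h1 hq hBq hcq hr hBr hcr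
    · exact h.false_of_slidesOverBeads hL h1 hq hBq hcq hr hBr hcr
  have hm1 : i + L < p := by
    by_contra hcon
    have := hnear p i hc (by omega) (by omega)
    omega
  have hm1c := hLL i
  have hm2c := (hLm p).trans hc
  have hne : ∀ x y, y % L = i % L → y < x → x < y + L → x % L ≠ i % L := fun x y h1 h2 h3 h4 => by
    have := hnear x y (by omega) (by omega) (by omega)
    omega
  have hgaps : ¬ B (p - L) → SlidesOverGaps L B (p - L) := by
    intro hB
    refine (h.slidesOver (p - L) (by simpa using hp) hB).resolve_right fun hv => ?_
    exact hne (p - L + 1) (p - L) hm2c (by omega) (by omega)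
      (hhigh (p - L) (by omega) (by omega) hm2c hB _ (by omega) (hv.2 _ (by omega) (by omega)))
  have hbeads : B (i + L) → SlidesOverBeads L B i := by
    intro hB
    refine (h.slidesOver i hB hi).resolve_left fun hv => ?_
    exact hne (i + 1) i rfl (by omega) (by omega)
      (hlow (i + L) (by omega) (by omega) hm1c hB _ (by omega) (hv.2 _ (by omega) (by omega)))
  by_cases h2 : p = i + L + L
  · by_cases hB : B (i + L)
    · have hv := hbeads hB
      refine h.not_beads_gaps i ⟨hv, ?_⟩
      refine ((h.slide_beads i hv).slidesOver (i := i + L) ?_ ?_).resolve_right fun hb => ?_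
      · exact Or.inr ⟨by rwa [← h2], by omega⟩
      · rintro (h3 | h3)
        · omega
        · exact h3.2 rfl
      · have hq' : i + L < q := by
          by_contra hcon
          rcases (not_lt.1 hcon).eq_or_lt with h3 | h3
          · exact hBq (h3 ▸ hB)
          · exact hcq (by rw [hlow _ (by omega) hm1 hm1c hB q h3 hBq, hc])
        rcases hb.2 q hq' (by omega) with h3 | h3
        · omega
        · exact hBq h3.1
    · have hpl : p - L = i + L := by omega
      have hg := hgaps (by rwa [hpl])
      rw [hpl] at hg
      refine h.not_gaps_beads (i + L) ⟨hg, ?_⟩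
      rw [add_sub_cancel_right]
      refine ((h.slide_gaps _ hg).slidesOver (i := i) ?_ ?_).resolve_left fun hb => ?_
      · exact Or.inl rfl
      · rintro (h3 | h3)
        · omega
        · exact hi h3.1
      · have hr' : r < i + L := by
          by_contra hcon
          rcases (not_lt.1 hcon).eq_or_lt with h3 | h3
          · exact hB (h3 ▸ hBr)
          · exact hcr (hhigh _ (by omega) hm1 hm1c hB r h3 hBr)
        exact hb.2 r hr.le hr' (Or.inr ⟨hBr, by omega⟩)
  have hm2 : i + L < p - L := by
    by_contra hcon
    have := hnear p (i + L) (by rw [hc, hm1c]) (by omega) (by omega)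
    omega
  have hG : ¬ B (p - L) → ¬ B (p - L - L) → i < p - L - L → False := by
    intro h3 h4 h5
    have hc4 : (p - L - L) % L = i % L := by rw [hLm, hm2c]
    refine h.slide_gaps _ (hgaps h3) (p - L) i (p - L - L + 1) r (Or.inl rfl) ?_ (by omega) hm2c
      (by omega) ?_ ?_ hr ?_ hcr
    · rintro (h6 | h6)
      · omega
      · exact hi h6.1
    · rintro (h6 | h6)
      · omega
      · exact hne _ _ hc4 (by omega) (by omega)
          (hhigh _ h5 (by omega) hc4 h4 (p - L - L + 1) (by omega) h6.1)
    · rw [hm2c]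
      exact hne _ _ hc4 (by omega) (by omega)
    · refine Or.inr ⟨hBr, ?_⟩
      rintro rfl
      apply hcr
      rw [hLL, hm2c]
  have hV : B (i + L) → B (i + L + L) → i + L + L < p → False := by
    intro h3 h4 h5
    have hc4 : (i + L + L) % L = i % L := by rw [hLL, hm1c]
    refine h.slide_beads _ (hbeads h3) p (i + L) q (i + L + 1) (Or.inr ⟨hp, by omega⟩) ?_ (by omega)
      (by rw [hc, hm1c]) hq ?_ hcq (by omega) (Or.inr ⟨?_, by omega⟩) ?_
    · rintro (h6 | h6)
      · omega
      · exact h6.2 rfl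
    · rintro (h6 | h6)
      · subst h6
        exact hcq hc.symm
      · exact hBq h6.1
    · by_contra h6
      exact hne (i + L + 1) _ hm1c (by omega) (by omega)
          (hlow _ (by omega) h5 hc4 h4 (i + L + 1) (by omega) h6)
    · rw [hm1c]
      exact hne _ _ hm1c (by omega) (by omega)
  have hmono : ∀ m m', i < m → m < m' → m' < p → m % L = i % L → m' % L = i % L → ¬ B m →
      ¬ B m' := by
    intro m m' h3 h4 h5 h6 h7 h8 h9
    have h10 := hne (m + 1) m h6 (by omega) (by omega)
    have h11 : m + L ≤ m' := by
      by_contra hcon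
      have := hnear m m' (by omega) (by omega) (by omega)
      omega
    by_cases h12 : B (m + 1)
    · exact h10 (hhigh m h3 (by omega) h6 h8 _ (by omega) h12)
    · exact h10 (hlow m' (by omega) h5 h7 h9 _ (by omega) h12)
  have hB1 : B (i + L) := by
    by_contra hB
    have h3 := hmono _ (p - L) (by omega) hm2 (by omega) hm1c hm2c hB
    by_cases h4 : i + L = p - L - L
    · exact hG h3 (h4 ▸ hB) (by omega)
    · have h5 : i + L < p - L - L := by
        by_contra hcon
        have := hnear (p - L) (i + L) (by omega) (by omega) (by omega)
        omega
      exact hG h3 (hmono _ _ (by omega) h5 (by omega) hm1c (by rw [hLm, hm2c]) hB) (by omega)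
  have h5 : i + L + L ≤ p - L := by
    by_contra hcon
    have := hnear (p - L) (i + L) (by omega) (by omega) (by omega)
    omega
  have hB3 : ¬ B (i + L + L) := fun hB => hV hB1 hB (by omega)
  have h6 : i + L + L = p - L := by
    by_contra hcon
    have h8 : i + L + L ≤ p - L - L := by
      by_contra hcon
      have := hnear (p - L) (i + L + L) (by rw [hLL]; omega) (by omega) (by omega)
      omega
    have h7 := hmono (i + L + L) (p - L) (by omega) (by omega) (by omega) (by rw [hLL, hm1c]) hm2c
      hB3
    refine hG h7 ?_ (by omega)
    rcases h8.eq_or_lt with h9 | h9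
    · rwa [← h9]
    · exact hmono (i + L + L) (p - L - L) (by omega) h9 (by omega) (by rw [hLL, hm1c])
        (by rw [hLm, hm2c]) hB3
  have hB2 : ¬ B (p - L) := h6 ▸ hB3
  by_cases h7 : ∃ x, i + L < x ∧ x < p - L ∧ ¬ B x
  · obtain ⟨x, hx1, hx2, hx⟩ := h7
    refine h.slide_gaps _ (hgaps hB2) (p - L) i x r (Or.inl rfl) ?_ (by omega) hm2c hx2 ?_ ?_ hr
      (Or.inr ⟨hBr, ?_⟩) hcr
    · rintro (h6 | h6)
      · omega
      · exact hi h6.1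
    · rintro (h6 | h6)
      · omega
      · exact hx h6.1
    · rw [hm2c]
      exact hne _ _ hm1c hx1 (by omega)
    · rintro rfl
      exact hcr (by rw [hLL, hm2c])
  · push Not at h7
    refine h.slide_beads _ (hbeads hB1) p (i + L) (p - L + 1) (i + L + 1) (Or.inr ⟨hp, by omega⟩)
      ?_ (by omega) (by rw [hc, hm1c]) (by omega) ?_ ?_ (by omega)
      (Or.inr ⟨h7 _ (by omega) (by omega), by omega⟩) ?_
    · rintro (h6 | h6)
      · omega
      · exact h6.2 rfl
    · rintro (h6 | h6)
      · omega
      · exact hne _ _ hm2c (by omega) (by omega)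
          (hhigh _ (by omega) (by omega) hm2c hB2 (p - L + 1) (by omega) h6.1)
    · rw [hc]
      exact hne _ _ hm2c (by omega) (by omega)
    · rw [hm1c]
      exact hne _ _ hm1c (by omega) (by omega)

end Beads
/-- The first row `r` for which `(r, r + n)` lies outside of `lam`. -/
noncomputable def rimRow (lam : YoungDiagram) (n : ℤ) : ℕ :=
  sInf {r : ℕ | (lam.rowLen r : ℤ) ≤ r + n}

/-- The set of beads of `lam`: the positions `rowLen a - a`. -/
def IsBead (lam : YoungDiagram) (n : ℤ) : Prop := ∃ a : ℕ, (lam.rowLen a : ℤ) - a = n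

section Rim

variable (lam : YoungDiagram)

theorem rimRow_le_iff {lam : YoungDiagram} {r : ℕ} {n : ℤ} :
    rimRow lam n ≤ r ↔ (lam.rowLen r : ℤ) ≤ r + n := by
  have hne : {r : ℕ | (lam.rowLen r : ℤ) ≤ r + n}.Nonempty := by
    refine ⟨lam.rowLen 0 + n.natAbs, ?_⟩
    have := lam.rowLen_anti 0 (lam.rowLen 0 + n.natAbs) (Nat.zero_le _)
    simp only [Set.mem_ofPred_eq]
    have := neg_abs_le n
    push_cast
    omega
  constructor
  · intro h
    have h1 := Nat.sInf_mem hne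
    have h2 := lam.rowLen_anti _ _ h
    simp only [Set.mem_ofPred_eq] at h1
    unfold rimRow at h h2
    omega
  · exact fun h => Nat.sInf_le h

theorem lt_rimRow_iff {lam : YoungDiagram} {r : ℕ} {n : ℤ} :
    r < rimRow lam n ↔ r + n < (lam.rowLen r : ℤ) := by
  rw [← not_le, rimRow_le_iff, not_le]

theorem mem_iff_lt_rimRow {lam : YoungDiagram} {r c : ℕ} :
    (r, c) ∈ lam ↔ r < rimRow lam (c - r) := by
  rw [lt_rimRow_iff, YoungDiagram.mem_iff_lt_rowLen]
  omega

theorem rimRow_add_nonneg (n : ℤ) : 0 ≤ rimRow lam n + n := by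
  have := (rimRow_le_iff (lam := lam) (n := n)).1 le_rfl
  omega

theorem rimRow_anti : Antitone (rimRow lam) := by
  intro m n h
  rw [rimRow_le_iff]
  have := (rimRow_le_iff (lam := lam) (n := m)).1 le_rfl
  omega

theorem rimRow_sub_one_le (n : ℤ) : rimRow lam (n - 1) ≤ rimRow lam n + 1 := by
  rw [rimRow_le_iff]
  have := (rimRow_le_iff (lam := lam) (n := n)).1 le_rfl
  have := lam.rowLen_anti _ _ (Nat.le_succ (rimRow lam n))
  simp only [Nat.succ_eq_add_one] at this
  omega

theorem isBead_iff (n : ℤ) : IsBead lam n ↔ rimRow lam (n - 1) = rimRow lam n + 1 := by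
  constructor
  · rintro ⟨a, ha⟩
    have h1 : a < rimRow lam (n - 1) := by rw [lt_rimRow_iff]; omega
    have h2 : rimRow lam n ≤ a := by rw [rimRow_le_iff]; omega
    have := rimRow_sub_one_le lam n
    omega
  · intro h
    refine ⟨rimRow lam n, ?_⟩
    have h1 : rimRow lam n < rimRow lam (n - 1) := by omega
    rw [lt_rimRow_iff] at h1
    have := (rimRow_le_iff (lam := lam) (n := n)).1 le_rfl
    omega

theorem not_isBead_iff (n : ℤ) : ¬ IsBead lam n ↔ rimRow lam (n - 1) = rimRow lam n := by
  rw [isBead_iff]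
  have := rimRow_sub_one_le lam n
  have := rimRow_anti lam (show n - 1 ≤ n by omega)
  omega

theorem not_isBead_iff_exists (n : ℤ) : ¬ IsBead lam n ↔ ∃ b : ℕ, (b : ℤ) + 1 - lam.colLen b = n := by
  constructor
  · rw [not_isBead_iff]
    intro h
    have h0 := rimRow_add_nonneg lam (n - 1)
    rw [h] at h0
    obtain ⟨b, hb⟩ := Int.eq_ofNat_of_zero_le h0
    refine ⟨b, ?_⟩
    have h1 : (rimRow lam n, b) ∉ lam := by
      rw [mem_iff_lt_rimRow, show (b : ℤ) - rimRow lam n = n - 1 by omega, h]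
      exact lt_irrefl _
    rw [YoungDiagram.mem_iff_lt_colLen] at h1
    have h2 : rimRow lam n ≤ lam.colLen b := by
      by_contra hcon
      have h3 : (rimRow lam n - 1, b) ∉ lam := by
        rw [YoungDiagram.mem_iff_lt_colLen]
        omega
      rw [mem_iff_lt_rimRow] at h3
      rw [show ((b : ℤ) - (rimRow lam n - 1 : ℕ)) = n by omega] at h3
      omega
    omega
  · rintro ⟨b, hb⟩ ⟨a, ha⟩
    have h1 := YoungDiagram.mem_iff_lt_rowLen (μ := lam) (i := a) (j := b)
    have h2 := YoungDiagram.mem_iff_lt_colLen (μ := lam) (i := a) (j := b)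
    have h3 := h1.symm.trans h2
    omega

theorem mem_iff_lt {a b : ℕ} :
    (a, b) ∈ lam ↔ (b : ℤ) + 1 - lam.colLen b < (lam.rowLen a : ℤ) - a := by
  have h1 := YoungDiagram.mem_iff_lt_rowLen (μ := lam) (i := a) (j := b)
  have h2 := YoungDiagram.mem_iff_lt_colLen (μ := lam) (i := a) (j := b)
  have h3 := h1.symm.trans h2
  rw [h1]
  omega

theorem dvd_hookLen_iff {ℓ a b : ℕ} (h : (a, b) ∈ lam) :
    ℓ ∣ hookLen lam a b ↔
      ((lam.rowLen a : ℤ) - a) % ℓ = ((b : ℤ) + 1 - lam.colLen b) % ℓ := by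
  have h1 := YoungDiagram.mem_iff_lt_rowLen.1 h
  have h2 := YoungDiagram.mem_iff_lt_colLen.1 h
  have h3 : (hookLen lam a b : ℤ) =
      ((lam.rowLen a : ℤ) - a) - ((b : ℤ) + 1 - lam.colLen b) := by
    unfold hookLen
    omega
  rw [← Int.natCast_dvd_natCast, h3]
  rw [Int.emod_eq_emod_iff_emod_sub_eq_zero, Int.dvd_iff_emod_eq_zero]

theorem isJM_iff_beadJM (ℓ : ℕ) : IsJM ℓ lam ↔ BeadJM ℓ (IsBead lam) := by
  constructor
  · intro h p i q r hp hi hip hc hq hBq hcq hr hBr hcr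
    rw [not_isBead_iff_exists] at hi hBq
    obtain ⟨a, rfl⟩ := hp
    obtain ⟨x, rfl⟩ := hBr
    obtain ⟨b, rfl⟩ := hi
    obtain ⟨y, rfl⟩ := hBq
    rw [← mem_iff_lt] at hip hq hr
    exact h ⟨a, b, x, y, hip, hq, hr, (dvd_hookLen_iff lam hip).2 hc,
      fun h => hcq ((dvd_hookLen_iff lam hq).1 h).symm, fun h => hcr ((dvd_hookLen_iff lam hr).1 h)⟩
  · rintro h ⟨a, b, x, y, h1, h2, h3, h4, h5, h6⟩
    rw [dvd_hookLen_iff lam h1] at h4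
    rw [dvd_hookLen_iff lam h2] at h5
    rw [dvd_hookLen_iff lam h3] at h6
    rw [mem_iff_lt] at h1 h2 h3
    exact h _ _ _ _ ⟨a, rfl⟩ ((not_isBead_iff_exists lam _).2 ⟨b, rfl⟩) h1 h4 h2
      ((not_isBead_iff_exists lam _).2 ⟨y, rfl⟩) (fun h => h5 h.symm) h3 ⟨x, rfl⟩ h6

theorem rimRow_add_mono : Monotone fun n : ℤ => rimRow lam n + n := by
  refine monotone_int_of_le_succ fun n => ?_
  have := rimRow_sub_one_le lam (n + 1)
  rw [add_sub_cancel_right] at this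
  omega

theorem rimRow_eq {μ : YoungDiagram} {n : ℤ} {k : ℕ} (hk : 0 ≤ k + n)
    (h : ∀ r c : ℕ, (c : ℤ) - r = n → ((r, c) ∈ μ ↔ r < k)) : rimRow μ n = k := by
  have h0 := rimRow_add_nonneg μ n
  rcases lt_trichotomy (rimRow μ n) k with hlt | heq | hlt
  · have h1 := h (rimRow μ n) (rimRow μ n + n).toNat (by omega)
    rw [mem_iff_lt_rimRow, Int.toNat_of_nonneg h0, add_sub_cancel_left] at h1
    omega
  · exact heq
  · have h1 := h k (k + n).toNat (by omega)
    rw [mem_iff_lt_rimRow, Int.toNat_of_nonneg hk, add_sub_cancel_left] at h1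
    omega

/-- The boxes on the rim of `lam` whose contents lie in `[i, i + ℓ)`. -/
noncomputable def rimHook (ℓ : ℕ) (i : ℤ) : Finset (ℕ × ℕ) :=
  lam.cells.filter fun x =>
    i ≤ (x.2 : ℤ) - x.1 ∧ (x.2 : ℤ) - x.1 < i + ℓ ∧ rimRow lam (x.2 - x.1) = x.1 + 1

variable {lam} {ℓ : ℕ} {i : ℤ}

theorem mem_rimHook {r c : ℕ} : (r, c) ∈ rimHook lam ℓ i ↔
    i ≤ (c : ℤ) - r ∧ (c : ℤ) - r < i + ℓ ∧ rimRow lam (c - r) = r + 1 := by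
  unfold rimHook
  rw [Finset.mem_filter, YoungDiagram.mem_cells, mem_iff_lt_rimRow]
  simp only
  omega

theorem exists_mem_rimHook (hi : ¬ IsBead lam i) (hb : IsBead lam (i + ℓ)) {n : ℤ} (h1 : i ≤ n)
    (h2 : n < i + ℓ) : ∃ r c : ℕ, (c : ℤ) - r = n ∧ rimRow lam n = r + 1 ∧
      (r, c) ∈ rimHook lam ℓ i := by
  rw [not_isBead_iff] at hi
  rw [isBead_iff] at hb
  have h3 := rimRow_anti lam (show n ≤ i + ℓ - 1 by omega)
  have h4 : rimRow lam i + i ≤ rimRow lam n + n := rimRow_add_mono lam h1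
  have h5 := rimRow_add_nonneg lam (i - 1)
  have h6 : ((rimRow lam n - 1 + n).toNat : ℤ) - (rimRow lam n - 1 : ℕ) = n := by omega
  refine ⟨rimRow lam n - 1, (rimRow lam n - 1 + n).toNat, h6, by omega, ?_⟩
  rw [mem_rimHook, h6]
  omega

theorem rimRow_of_removed {μ : YoungDiagram} (hμ : μ.cells = lam.cells \ rimHook lam ℓ i)
    (hi : ¬ IsBead lam i) (hb : IsBead lam (i + ℓ)) (n : ℤ) :
    rimRow μ n + (if i ≤ n ∧ n < i + ℓ then 1 else 0) = rimRow lam n := by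
  have hmem : ∀ r c : ℕ, (r, c) ∈ μ ↔ (r, c) ∈ lam ∧ (r, c) ∉ rimHook lam ℓ i := fun r c => by
    rw [← YoungDiagram.mem_cells, hμ, Finset.mem_sdiff, YoungDiagram.mem_cells]
  split_ifs with h
  · obtain ⟨r₀, c₀, h1, h2, -⟩ := exists_mem_rimHook hi hb h.1 h.2
    rw [h2, rimRow_eq (k := r₀) (by omega)]
    rintro r c rfl
    rw [hmem, mem_rimHook, mem_iff_lt_rimRow]
    omega
  · refine rimRow_eq (rimRow_add_nonneg lam n) ?_
    rintro r c rfl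
    rw [hmem, mem_rimHook, mem_iff_lt_rimRow]
    omega

theorem isBead_of_removed {μ : YoungDiagram} (hμ : μ.cells = lam.cells \ rimHook lam ℓ i)
    (hℓ : 0 < ℓ) (hi : ¬ IsBead lam i) (hb : IsBead lam (i + ℓ)) :
    IsBead μ = slide ℓ (IsBead lam) i := by
  funext n
  have h1 := rimRow_of_removed hμ hi hb n
  have h2 := rimRow_of_removed hμ hi hb (n - 1)
  rw [not_isBead_iff] at hi
  rw [isBead_iff] at hb
  rw [slide, isBead_iff, isBead_iff, eq_iff_iff]
  by_cases hn : n = i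
  · subst hn
    rw [if_pos (by omega)] at h1
    rw [if_neg (by omega)] at h2
    omega
  by_cases hn' : n = i + ℓ
  · subst hn'
    rw [if_neg (by omega)] at h1
    rw [if_pos (by omega)] at h2
    omega
  split_ifs at h1 h2 <;> omega

theorem exists_removed (hi : ¬ IsBead lam i) (hb : IsBead lam (i + ℓ)) :
    ∃ μ : YoungDiagram, μ.cells = lam.cells \ rimHook lam ℓ i := by
  refine ⟨⟨lam.cells \ rimHook lam ℓ i, ?_⟩, rfl⟩
  rintro ⟨r, c⟩ ⟨r', c'⟩ ⟨hr, hc⟩ hx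
  simp only [Finset.coe_sdiff, Set.mem_sdiff, Finset.mem_coe, YoungDiagram.mem_cells] at hx ⊢
  simp only at hr hc
  refine ⟨lam.up_left_mem hr hc hx.1, fun hy => hx.2 ?_⟩
  have hx1 := mem_iff_lt_rimRow.1 hx.1
  rw [mem_rimHook] at hy ⊢
  rw [not_isBead_iff] at hi
  rw [isBead_iff] at hb
  rcases le_total ((c' : ℤ) - r') (c - r) with h | h
  · have h1 := rimRow_anti lam h
    refine ⟨by omega, ?_, by omega⟩
    by_contra hcon
    have h2 := rimRow_anti lam (show i + ℓ ≤ (c : ℤ) - r by omega)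
    have h3 := rimRow_anti lam (show (c' : ℤ) - r' ≤ i + ℓ - 1 by omega)
    omega
  · have h1 : (rimRow lam (c - r) : ℤ) + (c - r) ≤ rimRow lam (c' - r') + (c' - r') :=
      rimRow_add_mono lam h
    refine ⟨?_, by omega, by omega⟩
    by_contra hcon
    have h2 : (rimRow lam (c - r) : ℤ) + (c - r) ≤ rimRow lam (i - 1) + (i - 1) :=
      rimRow_add_mono lam (by omega)
    have h3 : (rimRow lam i : ℤ) + i ≤ rimRow lam (c' - r') + (c' - r') :=
      rimRow_add_mono lam hy.1
    omega

theorem adjCell_of_content {r c r' c' : ℕ} (h : (c : ℤ) - r + 1 = c' - r')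
    (hr : r = r' ∨ r = r' + 1) : AdjCell (r, c) (r', c') := by
  simp only [AdjCell]
  omega

theorem AdjCell.symm {x y : ℕ × ℕ} (h : AdjCell x y) : AdjCell y x := by
  unfold AdjCell at *
  omega

theorem connectedCells_rimHook (hi : ¬ IsBead lam i) (hb : IsBead lam (i + ℓ)) :
    ConnectedCells (rimHook lam ℓ i) := by
  have key : ∀ k : ℕ, ∀ x ∈ rimHook lam ℓ i, ∀ y ∈ rimHook lam ℓ i,
      (y.2 : ℤ) - y.1 = x.2 - x.1 + k →
      Relation.ReflTransGen (fun x y => x ∈ rimHook lam ℓ i ∧ y ∈ rimHook lam ℓ i ∧ AdjCell x y)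
        x y := by
    intro k
    induction k with
    | zero =>
      rintro ⟨r, c⟩ hx ⟨r', c'⟩ hy h
      simp only [Nat.cast_zero, add_zero] at h
      rw [mem_rimHook] at hx hy
      rw [h] at hy
      obtain rfl : r' = r := by omega
      obtain rfl : c' = c := by omega
      exact .refl
    | succ k ih =>
      rintro ⟨r, c⟩ hx ⟨r', c'⟩ hy h
      have hx' := mem_rimHook.1 hx
      have hy' := mem_rimHook.1 hy
      push_cast at h
      obtain ⟨a, b, h1, h2, h3⟩ := exists_mem_rimHook hi hb (n := (c' : ℤ) - r' - 1)
        (by omega) (by omega)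
      refine (ih _ hx _ h3 (by simp only; omega)).tail ⟨h3, hy, adjCell_of_content (by omega) ?_⟩
      have h4 := rimRow_sub_one_le lam (c' - r')
      have h5 := rimRow_anti lam (show (c' : ℤ) - r' - 1 ≤ c' - r' by omega)
      omega
  intro x hx y hy
  rcases le_total ((x.2 : ℤ) - x.1) (y.2 - y.1) with h | h
  · exact key ((y.2 - y.1) - (x.2 - x.1) : ℤ).toNat x hx y hy (by omega)
  · have : Std.Symm fun x y => x ∈ rimHook lam ℓ i ∧ y ∈ rimHook lam ℓ i ∧ AdjCell x y :=
      ⟨fun a b hab => ⟨hab.2.1, hab.1, hab.2.2.symm⟩⟩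
    exact Relation.ReflTransGen.stdSymm.symm _ _ (key ((x.2 - x.1) - (y.2 - y.1) : ℤ).toNat y hy x hx (by omega))

theorem card_rimHook (hi : ¬ IsBead lam i) (hb : IsBead lam (i + ℓ)) :
    (rimHook lam ℓ i).card = ℓ := by
  have h1 : (rimHook lam ℓ i).image (fun x => (x.2 : ℤ) - x.1) = Finset.Ico i (i + ℓ) := by
    ext n
    rw [Finset.mem_image, Finset.mem_Ico]
    constructor
    · rintro ⟨⟨r, c⟩, hx, rfl⟩
      rw [mem_rimHook] at hx
      exact ⟨hx.1, hx.2.1⟩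
    · rintro ⟨h1, h2⟩
      obtain ⟨r, c, h3, -, h4⟩ := exists_mem_rimHook hi hb h1 h2
      exact ⟨(r, c), h4, h3⟩
  have h2 : Set.InjOn (fun x : ℕ × ℕ => (x.2 : ℤ) - x.1) (rimHook lam ℓ i) := by
    rintro ⟨r, c⟩ hx ⟨r', c'⟩ hy h
    simp only at h
    rw [Finset.mem_coe, mem_rimHook] at hx hy
    rw [h] at hx
    ext <;> simp only <;> omega
  rw [← Finset.card_image_of_injOn h2, h1, Int.card_Ico]
  omega

theorem isRemovableRimHook_rimHook (hi : ¬ IsBead lam i) (hb : IsBead lam (i + ℓ)) :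
    IsRemovableRimHook ℓ lam (rimHook lam ℓ i) := by
  obtain ⟨μ, hμ⟩ := exists_removed hi hb
  refine ⟨μ, hμ ▸ Finset.sdiff_subset, ?_, card_rimHook hi hb, connectedCells_rimHook hi hb, ?_⟩
  · exact hμ ▸ (Finset.sdiff_sdiff_eq_self (Finset.filter_subset _ _)).symm
  · rintro ⟨a, b, h1, -, -, h2⟩
    rw [mem_rimHook] at h1 h2
    rw [show ((b + 1 : ℕ) : ℤ) - (a + 1 : ℕ) = b - a by omega] at h2
    omega

theorem IsRemovableRimHook.eq_rimHook {s : Finset (ℕ × ℕ)} (hℓ : 0 < ℓ)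
    (hs : IsRemovableRimHook ℓ lam s) :
    ∃ i, ¬ IsBead lam i ∧ IsBead lam (i + ℓ) ∧ s = rimHook lam ℓ i := by
  obtain ⟨μ, hμ, rfl, hcard, hconn, hsq⟩ := hs
  set s := lam.cells \ μ.cells with hs
  have hmem : ∀ r c : ℕ, (r, c) ∈ s ↔ rimRow μ (c - r) ≤ r ∧ r < rimRow lam (c - r) := by
    intro r c
    rw [hs, Finset.mem_sdiff, YoungDiagram.mem_cells, YoungDiagram.mem_cells, mem_iff_lt_rimRow,
      mem_iff_lt_rimRow]
    omega
  have hle : ∀ n, rimRow lam n ≤ rimRow μ n + 1 := by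
    intro n
    by_contra hcon
    have h0 := rimRow_add_nonneg μ n
    obtain ⟨c, hc⟩ := Int.eq_ofNat_of_zero_le h0
    generalize hr : rimRow μ n = r at hc hcon
    obtain rfl : n = c - r := by omega
    have h1 := rimRow_sub_one_le μ (c - r)
    have h2 := rimRow_anti lam (show (c : ℤ) - r - 1 ≤ c - r by omega)
    have h3 := rimRow_anti μ (show (c : ℤ) - r ≤ c - r + 1 by omega)
    have h4 := rimRow_sub_one_le lam (c - r + 1)
    rw [add_sub_cancel_right] at h4
    refine hsq ⟨r, c, (hmem _ _).2 ?_, (hmem _ _).2 ?_, (hmem _ _).2 ?_, (hmem _ _).2 ?_⟩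
    · omega
    · rw [show (c : ℤ) - (r + 1 : ℕ) = c - r - 1 by omega]
      omega
    · rw [show ((c + 1 : ℕ) : ℤ) - r = c - r + 1 by omega]
      omega
    · rw [show ((c + 1 : ℕ) : ℤ) - (r + 1 : ℕ) = c - r by omega]
      omega
  set C := s.image (fun x => (x.2 : ℤ) - x.1) with hC
  have hmemC : ∀ n, n ∈ C ↔ rimRow lam n = rimRow μ n + 1 := by
    intro n
    rw [hC, Finset.mem_image]
    constructor
    · rintro ⟨⟨r, c⟩, hx, rfl⟩
      have h1 := (hmem r c).1 hx
      have h2 := hle (c - r)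
      simp only
      omega
    · intro h
      have h1 : ((rimRow μ n + n).toNat : ℤ) - rimRow μ n = n := by
        have := rimRow_add_nonneg μ n
        omega
      refine ⟨(rimRow μ n, (rimRow μ n + n).toNat), (hmem _ _).2 ?_, h1⟩
      rw [h1]
      omega
  have hnotC : ∀ n, n ∉ C → rimRow lam n = rimRow μ n := by
    intro n hn
    rw [hmemC] at hn
    have h1 := hle n
    by_contra hcon
    have h2 : ((rimRow lam n + n).toNat : ℤ) - rimRow lam n = n := by
      have := rimRow_add_nonneg lam n
      omega
    have h3 : (rimRow lam n, (rimRow lam n + n).toNat) ∈ μ := by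
      rw [mem_iff_lt_rimRow, h2]
      omega
    have h4 := hμ ((YoungDiagram.mem_cells _).2 h3)
    rw [YoungDiagram.mem_cells, mem_iff_lt_rimRow, h2] at h4
    omega
  have hcardC : C.card = ℓ := by
    rw [hC, Finset.card_image_of_injOn, hcard]
    rintro ⟨r, c⟩ hx ⟨r', c'⟩ hy h
    simp only at h
    rw [Finset.mem_coe, hmem] at hx hy
    have h1 := hle (c - r)
    rw [← h] at hy
    ext <;> simp only <;> omega
  have hne : C.Nonempty := Finset.card_pos.1 (by omega)
  have hIcc : C = Finset.Icc (C.min' hne) (C.max' hne) := by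
    refine subset_antisymm
      (fun n hn => Finset.mem_Icc.2 ⟨C.min'_le n hn, C.le_max' n hn⟩) fun n hn => ?_
    rw [Finset.mem_Icc] at hn
    have hmin := C.min'_mem hne
    have hmax := C.max'_mem hne
    generalize C.min' hne = m at *
    generalize C.max' hne = M at *
    obtain ⟨x, hx, rfl⟩ := Finset.mem_image.1 hmin
    obtain ⟨y, hy, rfl⟩ := Finset.mem_image.1 hmax
    have hstep : ∀ z, Relation.ReflTransGen (fun x y => x ∈ s ∧ y ∈ s ∧ AdjCell x y) x z →
        ∀ n, (x.2 : ℤ) - x.1 ≤ n → n ≤ (z.2 : ℤ) - z.1 → n ∈ C := by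
      intro z hz
      induction hz with
      | refl =>
        intro n h1 h2
        rwa [le_antisymm h2 h1]
      | @tail a b _ hab ih =>
        intro n h1 h2
        by_cases hn : n ≤ (a.2 : ℤ) - a.1
        · exact ih n h1 hn
        · have := hab.2.2
          unfold AdjCell at this
          exact Finset.mem_image.2 ⟨b, hab.2.1, by omega⟩
    exact hstep y (hconn x hx y hy) n hn.1 hn.2
  have hlen : C.max' hne = C.min' hne + ℓ - 1 := by
    have h1 := congrArg Finset.card hIcc
    rw [Int.card_Icc, hcardC] at h1
    omega
  generalize C.min' hne = m at *
  rw [hlen] at hIcc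
  have hmemC' : ∀ n, n ∈ C ↔ m ≤ n ∧ n < m + ℓ := by
    intro n
    rw [hIcc, Finset.mem_Icc]
    omega
  refine ⟨m, ?_, ?_, ?_⟩
  · rw [not_isBead_iff]
    have h1 := hnotC (m - 1) (by rw [hmemC']; omega)
    have h2 := (hmemC m).1 (by rw [hmemC']; omega)
    have h3 := rimRow_sub_one_le μ m
    have h4 := rimRow_anti lam (show m - 1 ≤ m by omega)
    omega
  · rw [isBead_iff]
    have h1 := hnotC (m + ℓ) (by rw [hmemC']; omega)
    have h2 := (hmemC (m + ℓ - 1)).1 (by rw [hmemC']; omega)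
    have h3 := rimRow_sub_one_le lam (m + ℓ)
    have h4 := rimRow_anti μ (show m + ℓ - 1 ≤ m + ℓ by omega)
    omega
  · ext ⟨r, c⟩
    rw [hmem, mem_rimHook]
    constructor
    · intro h
      have h1 := hle (c - r)
      have h2 := (hmemC' (c - r)).1 ((hmemC _).2 (by omega))
      omega
    · rintro ⟨h1, h2, h3⟩
      have h4 := (hmemC (c - r)).1 ((hmemC' _).2 ⟨h1, h2⟩)
      omega

theorem slidesOverGaps_iff_horizontalCells (hi : ¬ IsBead lam i) (hb : IsBead lam (i + ℓ)) :
    SlidesOverGaps ℓ (IsBead lam) i ↔ HorizontalCells (rimHook lam ℓ i) := by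
  constructor
  · intro h
    have key : ∀ n, i ≤ n → n < i + ℓ → rimRow lam n = rimRow lam i := by
      intro n hn
      induction n, hn using Int.leInduction with
      | base => exact fun _ => rfl
      | succ n hn ih =>
        intro h1
        rw [← ih (by omega)]
        have h2 := h.2 (n + 1) (by omega) h1
        rw [not_isBead_iff, add_sub_cancel_right] at h2
        exact h2.symm
    rintro ⟨r, c⟩ hx ⟨r', c'⟩ hy
    rw [mem_rimHook] at hx hy
    have h1 := key _ hx.1 hx.2.1
    have h2 := key _ hy.1 hy.2.1
    simp only
    omega
  · refine fun h => ⟨hb, fun n hn hn' hB => ?_⟩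
    rcases hn.eq_or_lt with rfl | hn
    · exact hi hB
    obtain ⟨r, c, -, h2, h3⟩ := exists_mem_rimHook hi hb hn.le hn'
    obtain ⟨r', c', -, h2', h3'⟩ :=
      exists_mem_rimHook hi hb (n := n - 1) (by omega) (by omega)
    have h4 := h _ h3 _ h3'
    rw [isBead_iff] at hB
    simp only at h4
    omega

theorem slidesOverBeads_iff_verticalCells (hi : ¬ IsBead lam i) (hb : IsBead lam (i + ℓ)) :
    SlidesOverBeads ℓ (IsBead lam) i ↔ VerticalCells (rimHook lam ℓ i) := by
  constructor
  · intro h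
    have key : ∀ n, i ≤ n → n < i + ℓ → rimRow lam n + n = rimRow lam i + i := by
      intro n hn
      induction n, hn using Int.leInduction with
      | base => exact fun _ => rfl
      | succ n hn ih =>
        intro h1
        rw [← ih (by omega)]
        have h2 := h.2 (n + 1) (by omega) (by omega)
        rw [isBead_iff, add_sub_cancel_right] at h2
        omega
    rintro ⟨r, c⟩ hx ⟨r', c'⟩ hy
    rw [mem_rimHook] at hx hy
    have h1 := key _ hx.1 hx.2.1
    have h2 := key _ hy.1 hy.2.1
    simp only
    omega
  · refine fun h => ⟨hi, fun n hn hn' => ?_⟩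
    by_contra hB
    rcases hn'.eq_or_lt with rfl | hn'
    · exact hB hb
    obtain ⟨r, c, h1, h2, h3⟩ := exists_mem_rimHook hi hb hn.le hn'
    obtain ⟨r', c', h1', h2', h3'⟩ :=
      exists_mem_rimHook hi hb (n := n - 1) (by omega) (by omega)
    have h4 := h _ h3 _ h3'
    rw [not_isBead_iff] at hB
    simp only at h4
    omega

theorem exists_content_of_adjacentSets {μ : YoungDiagram} {i' : ℤ}
    (h : AdjacentSets (rimHook lam ℓ i) (rimHook μ ℓ i')) :
    ∃ n n' : ℤ, i ≤ n ∧ n < i + ℓ ∧ i' ≤ n' ∧ n' < i' + ℓ ∧ n ≤ n' + 1 ∧ n' ≤ n + 1 := by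
  obtain ⟨⟨r, c⟩, hx, ⟨r', c'⟩, hy, hadj⟩ := h
  rw [mem_rimHook] at hx hy
  simp only [AdjCell] at hadj
  exact ⟨c - r, c' - r', by omega⟩

theorem IsJM.of_removeHV {μ : YoungDiagram} (hℓ : 2 < ℓ) (h : IsJM ℓ lam)
    (hμ : RemoveHV ℓ lam μ) : IsJM ℓ μ := by
  obtain ⟨s, hs, hor, hcells⟩ := hμ
  obtain ⟨i, hi, hb, rfl⟩ := hs.eq_rimHook (by omega)
  rw [isJM_iff_beadJM] at *
  rw [isBead_of_removed hcells (by omega) hi hb]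
  rw [← slidesOverGaps_iff_horizontalCells hi hb, ← slidesOverBeads_iff_verticalCells hi hb] at hor
  rcases hor with h1 | h1
  · exact h.slide_gaps (by omega) h1
  · exact h.slide_beads (by omega) h1

theorem IsJM.cond12 (hℓ : 2 < ℓ) (h : IsJM ℓ lam) : Cond12 ℓ lam := by
  rw [isJM_iff_beadJM] at h
  constructor
  · intro s hs
    obtain ⟨i, hi, hb, rfl⟩ := hs.eq_rimHook (by omega)
    rw [← slidesOverGaps_iff_horizontalCells hi hb, ← slidesOverBeads_iff_verticalCells hi hb]
    exact h.slidesOver hb hi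
  · intro R ν S hR hν hS hRS hadj
    obtain ⟨i, hi, hb, rfl⟩ := hR.eq_rimHook (by omega)
    obtain ⟨i', hi', hb', rfl⟩ := hS.eq_rimHook (by omega)
    rw [← slidesOverGaps_iff_horizontalCells hi hb, ← slidesOverBeads_iff_verticalCells hi hb,
      ← slidesOverGaps_iff_horizontalCells hi' hb', ← slidesOverBeads_iff_verticalCells hi' hb',
      isBead_of_removed hν (by omega) hi hb] at hRS
    obtain ⟨n, n', h1, h2, h3, h4, h5, h6⟩ := exists_content_of_adjacentSets hadj
    rcases hRS with ⟨hv, hg⟩ | ⟨hg, hv⟩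
    · exact h.not_beads_gaps (by omega) hv hg h1 h2 h3 h4 h5 h6
    · exact h.not_gaps_beads (by omega) hg hv h1 h2 h3 h4 h5 h6

theorem IsGeneralized.isJM (hℓ : 2 < ℓ) (h : IsGeneralized ℓ lam) : IsJM ℓ lam := by
  induction hd : lam.card using Nat.strong_induction_on generalizing lam with
  | _ d ih =>
  subst hd
  have h12 := h lam .refl
  have hslide : ∀ i, ¬ IsBead lam i → IsBead lam (i + ℓ) →
      (HorizontalCells (rimHook lam ℓ i) ∨ VerticalCells (rimHook lam ℓ i)) →
      BeadJM ℓ (slide ℓ (IsBead lam) i) := by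
    intro i hi hb hor
    obtain ⟨μ, hμ⟩ := exists_removed hi hb
    have hrem := isRemovableRimHook_rimHook hi hb
    rw [← isBead_of_removed hμ (by omega) hi hb, ← isJM_iff_beadJM]
    refine ih _ ?_ (fun ν hν => h ν (.head ⟨_, hrem, hor, hμ⟩ hν)) rfl
    have h1 := Finset.card_sdiff_add_card_eq_card
      (show rimHook lam ℓ i ⊆ lam.cells from Finset.filter_subset _ _)
    rw [← hμ, card_rimHook hi hb] at h1
    have h2 : μ.cells.card = μ.card := rfl
    have h3 : lam.cells.card = lam.card := rfl
    omega
  rw [isJM_iff_beadJM]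
  refine SlidesToJM.beadJM (by omega) ⟨fun i hb hi => ?_, fun i ⟨hg, hv⟩ => ?_,
    fun i ⟨hv, hg⟩ => ?_, fun i hg => ?_, fun i hv => ?_⟩
  · rw [slidesOverGaps_iff_horizontalCells hi hb, slidesOverBeads_iff_verticalCells hi hb]
    exact h12.1 _ (isRemovableRimHook_rimHook hi hb)
  · have hi := hg.2 i le_rfl (by omega)
    have hb := hg.1
    obtain ⟨μ, hμ⟩ := exists_removed hi hb
    rw [← isBead_of_removed hμ (by omega) hi hb] at hv
    have hi' := hv.1
    have hb' := hv.2 (i - ℓ + ℓ) (by omega) le_rfl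
    rw [slidesOverGaps_iff_horizontalCells hi hb] at hg
    rw [slidesOverBeads_iff_verticalCells hi' hb'] at hv
    refine h12.2 _ μ _ (isRemovableRimHook_rimHook hi hb) hμ (isRemovableRimHook_rimHook hi' hb')
      (Or.inr ⟨hg, hv⟩) ?_
    obtain ⟨r, c, h1, h2, h3⟩ := exists_mem_rimHook hi hb (n := i) le_rfl (by omega)
    obtain ⟨r', c', h1', h2', h3'⟩ :=
      exists_mem_rimHook hi' hb' (n := i - 1) (by omega) (by omega)
    refine ⟨_, h3, _, h3', (adjCell_of_content (by omega) (Or.inl ?_)).symm⟩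
    have h4 := rimRow_of_removed hμ hi hb (i - 1)
    rw [if_neg (by omega)] at h4
    rw [not_isBead_iff] at hi
    omega
  · have hi := hv.1
    have hb := hv.2 (i + ℓ) (by omega) le_rfl
    obtain ⟨μ, hμ⟩ := exists_removed hi hb
    rw [← isBead_of_removed hμ (by omega) hi hb] at hg
    have hi' := hg.2 _ le_rfl (by omega)
    have hb' := hg.1
    rw [slidesOverBeads_iff_verticalCells hi hb] at hv
    rw [slidesOverGaps_iff_horizontalCells hi' hb'] at hg
    refine h12.2 _ μ _ (isRemovableRimHook_rimHook hi hb) hμ (isRemovableRimHook_rimHook hi' hb')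
      (Or.inl ⟨hv, hg⟩) ?_
    obtain ⟨r, c, h1, h2, h3⟩ :=
      exists_mem_rimHook hi hb (n := i + ℓ - 1) (by omega) (by omega)
    obtain ⟨r', c', h1', h2', h3'⟩ :=
      exists_mem_rimHook hi' hb' (n := i + ℓ) le_rfl (by omega)
    refine ⟨_, h3, _, h3', adjCell_of_content (by omega) (Or.inr ?_)⟩
    have h4 := rimRow_of_removed hμ hi hb (i + ℓ)
    rw [if_neg (by omega)] at h4
    rw [isBead_iff] at hb
    omega
  · have hi := hg.2 i le_rfl (by omega)
    exact hslide i hi hg.1 (Or.inl ((slidesOverGaps_iff_horizontalCells hi hg.1).1 hg))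
  · have hb := hv.2 (i + ℓ) (by omega) le_rfl
    exact hslide i hv.1 hb (Or.inr ((slidesOverBeads_iff_verticalCells hv.1 hb).1 hv))

end Rim

/-- A partition is an `(ℓ,0)`-JM partition if and only if it is a generalized
`ℓ`-partition (for `ℓ > 2`). -/
theorem stmt_15 (ℓ : ℕ) (hℓ : 2 < ℓ) (lam : YoungDiagram) :
    IsJM ℓ lam ↔ IsGeneralized ℓ lam := by
  constructor
  · intro h μ hμ
    suffices IsJM ℓ μ from this.cond12 hℓ
    induction hμ with
    | refl => exact h
    | tail _ hstep ih => exact ih.of_removeHV hℓ hstep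
  · exact fun h => h.isJM hℓ
end
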